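/- arXiv:2506.03745 — 3 statements merged into one kernel-verified Lean document; each statement's English description precedes it below -/
import Mathlib

section
/- Let 0 → M → E → N → 0 be a short exact sequence of ℤ[τ]-lattices, with equivariant maps. Then there exist natural numbers k, l, ℤ[τ]-lattices M₀ and N₀, and equivariant isomorphisms M ≅ M₀ ⊕ ℤ[1]^k ⊕ ℤ[−1]^l, E ≅ (M₀ ⊕ N₀) ⊕ ℤ[τ]^k ⊕ ℤ[τ]^l, and N ≅ N₀ ⊕ ℤ[−1]^k ⊕ ℤ[1]^l under which the given sequence becomes the direct sum of the split sequence 0 → M₀ → M₀ ⊕ N₀ → N₀ → 0, of k copies of the elementary non-split sequence 0 → ℤ[1] → ℤ[τ] → ℤ[−1] → 0 (with maps 1 ↦ (1,1) and (a,b) ↦ a − b), and of l copies of the elementary non-split sequence 0 → ℤ[−1] → ℤ[τ] → ℤ[1] → 0 (with maps 1 ↦ (1,−1) and (a,b) ↦ a + b). -/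
/-- A map from a projective module lifts along any map whose range contains its values. -/
theorem Module.Projective.exists_lift_of_forall_exists {R N P M : Type*} [Ring R]
    [AddCommGroup N] [Module R N] [Module.Projective R N]
    [AddCommGroup P] [Module R P] [AddCommGroup M] [Module R M]
    (T : P →ₗ[R] M) (D : N →ₗ[R] M) (h : ∀ n, ∃ p, T p = D n) :
    ∃ y : N →ₗ[R] P, ∀ n, T (y n) = D n := by
  obtain ⟨y, hy⟩ := Module.projective_lifting_property T.rangeRestrict
    (D.codRestrict (LinearMap.range T) h) T.surjective_rangeRestrict
  exact ⟨y, fun n => congrArg Subtype.val (LinearMap.congr_fun hy n)⟩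

/-- If `x² = 0` on `V`, a map `ψ` commuting with `x` and sending `ker x` into `range x` is a
commutator-type sum `h x + x h`. -/
theorem LinearMap.exists_eq_comp_add_comp {K V W : Type*} [Field K] [AddCommGroup V] [Module K V]
    [AddCommGroup W] [Module K W] (xV : V →ₗ[K] V) (xW : W →ₗ[K] W) (ψ : V →ₗ[K] W)
    (hsq : ∀ v, xV (xV v) = 0) (hcomm : ∀ v, ψ (xV v) = xW (ψ v))
    (hker : ∀ v, xV v = 0 → ∃ w, xW w = ψ v) :
    ∃ h : V →ₗ[K] W, ∀ v, ψ v = h (xV v) + xW (h v) := by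
  obtain ⟨σ, hσ⟩ := xV.rangeRestrict.exists_rightInverse_of_surjective xV.range_rangeRestrict
  obtain ⟨p, hp⟩ := LinearMap.exists_extend σ
  have hxpx : ∀ v, xV (p (xV v)) = xV v := fun v => by
    have h1 : p (xV v) = σ (xV.rangeRestrict v) := LinearMap.congr_fun hp (xV.rangeRestrict v)
    rw [h1]
    exact congrArg Subtype.val (LinearMap.congr_fun hσ (xV.rangeRestrict v))
  let q : V →ₗ[K] V := LinearMap.id - p ∘ₗ xV - xV ∘ₗ p
  have hq : ∀ v, q v = v - p (xV v) - xV (p v) := fun v => rfl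
  have hxq : ∀ v, q v ∈ LinearMap.ker xV := fun v => by
    simp [hq, hxpx, hsq]
  obtain ⟨y, hy⟩ := Module.Projective.exists_lift_of_forall_exists xW
    (ψ ∘ₗ (LinearMap.ker xV).subtype) (fun v => hker v v.2)
  refine ⟨ψ ∘ₗ p + y ∘ₗ q.codRestrict _ hxq, fun v => ?_⟩
  have h1 : q.codRestrict (LinearMap.ker xV) hxq (xV v) = 0 := by
    ext
    simp [hq, hxpx, hsq]
  have h2 := hy (q.codRestrict (LinearMap.ker xV) hxq v)
  simp only [LinearMap.comp_apply, Submodule.subtype_apply, LinearMap.codRestrict_apply, hq,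
    map_sub] at h2
  simp only [LinearMap.add_apply, LinearMap.comp_apply, h1, map_zero, add_zero, map_add, h2,
    ← hcomm]
  abel

/-- A submodule containing `2 • M` is cut out, at the level of parities, by integral functionals. -/
theorem exists_functional_even_odd {M : Type*} [AddCommGroup M] [Module.Free ℤ M]
    (S : Submodule ℤ M) (hS : ∀ x, x + x ∈ S) (m : M) (hm : m ∉ S) :
    ∃ g : M →ₗ[ℤ] ℤ, (∀ x ∈ S, Even (g x)) ∧ Odd (g m) := by
  let _ : Module (ZMod 2) (M ⧸ S) := AddCommGroup.zmodModule fun x => by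
    obtain ⟨x, rfl⟩ := S.mkQ_surjective x
    rw [two_nsmul, ← map_add]
    exact (Submodule.Quotient.mk_eq_zero S).2 (hS x)
  have hm0 : S.mkQ m ≠ 0 := fun h => hm ((Submodule.Quotient.mk_eq_zero S).1 h)
  obtain ⟨φ, hφ⟩ : ∃ φ : Module.Dual (ZMod 2) (M ⧸ S), φ (S.mkQ m) ≠ 0 := by
    by_contra! hcon
    exact hm0 ((Module.forall_dual_apply_eq_zero_iff (ZMod 2) _).1 hcon)
  obtain ⟨g, hg⟩ := Module.Projective.exists_lift_of_forall_exists
    (Int.castAddHom (ZMod 2)).toIntLinearMap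
    (φ.toAddMonoidHom.toIntLinearMap ∘ₗ S.mkQ)
    (fun n => ZMod.intCast_surjective (n := 2) (φ (S.mkQ n)))
  replace hg : ∀ x, ((g x : ℤ) : ZMod 2) = φ (S.mkQ x) := hg
  refine ⟨g, fun x hx => ?_, ?_⟩
  · rw [← ZMod.intCast_eq_zero_iff_even, hg]
    have : S.mkQ x = 0 := (Submodule.Quotient.mk_eq_zero S).2 hx
    rw [this, map_zero]
  · rw [← Int.not_even_iff_odd, ← ZMod.intCast_eq_zero_iff_even, hg]
    exact hφ

/-- A nonzero functional is a multiple of one taking the value `1`. -/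
theorem exists_primitive_functional {M : Type*} [AddCommGroup M] [Module.Free ℤ M]
    (f : M →ₗ[ℤ] ℤ) (hf : f ≠ 0) :
    ∃ (d : ℤ) (f' : M →ₗ[ℤ] ℤ) (m : M), d ≠ 0 ∧ (∀ x, f x = d * f' x) ∧ f' m = 1 := by
  obtain ⟨d, hd⟩ := IsPrincipalIdealRing.principal (LinearMap.range f)
  obtain ⟨f', hf'⟩ := Module.Projective.exists_lift_of_forall_exists
    (LinearMap.toSpanSingleton ℤ ℤ d) f (fun x => by
      have : f x ∈ LinearMap.range f := ⟨x, rfl⟩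
      rw [hd, Submodule.mem_span_singleton] at this
      exact this)
  replace hf' : ∀ x, f x = d * f' x := fun x => by
    rw [← hf' x, LinearMap.toSpanSingleton_apply, smul_eq_mul, mul_comm]
  have hd0 : d ≠ 0 := by
    rintro rfl
    exact hf (LinearMap.ext fun x => by simp [hf' x])
  obtain ⟨m, hm⟩ : d ∈ LinearMap.range f := by
    rw [hd]; exact Submodule.mem_span_singleton_self d
  refine ⟨d, f', m, hd0, hf', ?_⟩
  rw [hf'] at hm
  exact mul_left_cancel₀ hd0 (by rw [hm, mul_one])

/-- A nonzero vector is a multiple of one on which some functional takes the value `1`. -/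
theorem exists_primitive_vector {N : Type*} [AddCommGroup N] [Module.Free ℤ N] [Module.Finite ℤ N]
    (n : N) (hn : n ≠ 0) :
    ∃ (d : ℤ) (n' : N) (p : N →ₗ[ℤ] ℤ), d ≠ 0 ∧ n = d • n' ∧ p n' = 1 := by
  have hev : Module.Dual.eval ℤ N n ≠ 0 := fun h =>
    hn ((Module.forall_dual_apply_eq_zero_iff ℤ n).1 fun φ => LinearMap.congr_fun h φ)
  obtain ⟨d, f', p, hd, hf', hp⟩ := exists_primitive_functional (M := Module.Dual ℤ N) _ hev
  obtain ⟨n', rfl⟩ := (Module.evalEquiv ℤ N).surjective f'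
  have hmul : ∀ φ : N →ₗ[ℤ] ℤ, φ n = d * φ n' := hf'
  refine ⟨d, n', p, hd, ?_, hp⟩
  rw [← sub_eq_zero]
  refine (Module.forall_dual_apply_eq_zero_iff ℤ _).1 fun φ => ?_
  rw [map_sub, map_smul, hmul, smul_eq_mul, sub_self]

/-- A short exact sequence of abelian groups with involutions. -/
structure IsInvolutiveSES {M E N : Type*} [AddCommGroup M] [AddCommGroup E] [AddCommGroup N]
    (τM : M →ₗ[ℤ] M) (τE : E →ₗ[ℤ] E) (τN : N →ₗ[ℤ] N)
    (ι : M →ₗ[ℤ] E) (π : E →ₗ[ℤ] N) : Prop where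
  involM : ∀ x, τM (τM x) = x
  involE : ∀ x, τE (τE x) = x
  involN : ∀ x, τN (τN x) = x
  map_ι : ∀ x, ι (τM x) = τE (ι x)
  map_π : ∀ x, π (τE x) = τN (π x)
  inj : Function.Injective ι
  surj : Function.Surjective π
  comp_zero : ∀ x, π (ι x) = 0
  exact : ∀ x, π x = 0 → ∃ m, ι m = x

/-- The sequence is a direct sum of a split sequence and of elementary non-split ones. -/
def HasElementaryDecomposition {M E N : Type*}
    [AddCommGroup M] [AddCommGroup E] [AddCommGroup N]
    (τM : M →ₗ[ℤ] M) (τE : E →ₗ[ℤ] E) (τN : N →ₗ[ℤ] N)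
    (ι : M →ₗ[ℤ] E) (π : E →ₗ[ℤ] N) : Prop :=
  ∃ (k l a b : ℕ)
    (σM : (Fin a → ℤ) →ₗ[ℤ] (Fin a → ℤ)) (σN : (Fin b → ℤ) →ₗ[ℤ] (Fin b → ℤ))
    (eM : M ≃ₗ[ℤ] (Fin a → ℤ) × (Fin k → ℤ) × (Fin l → ℤ))
    (eE : E ≃ₗ[ℤ] ((Fin a → ℤ) × (Fin b → ℤ)) × (Fin k → ℤ × ℤ) × (Fin l → ℤ × ℤ))
    (eN : N ≃ₗ[ℤ] (Fin b → ℤ) × (Fin k → ℤ) × (Fin l → ℤ)),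
    (∀ x, σM (σM x) = x) ∧ (∀ x, σN (σN x) = x) ∧
    (∀ m : M, eM (τM m) = (σM (eM m).1, (eM m).2.1, -(eM m).2.2)) ∧
    (∀ x : E, eE (τE x) =
      ((σM (eE x).1.1, σN (eE x).1.2),
        fun i => ((eE x).2.1 i).swap, fun i => ((eE x).2.2 i).swap)) ∧
    (∀ y : N, eN (τN y) = (σN (eN y).1, -(eN y).2.1, (eN y).2.2)) ∧
    (∀ m : M, eE (ι m) =
      (((eM m).1, 0),
        fun i => ((eM m).2.1 i, (eM m).2.1 i),
        fun i => ((eM m).2.2 i, -(eM m).2.2 i))) ∧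
    (∀ x : E, eN (π x) =
      ((eE x).1.2,
        fun i => ((eE x).2.1 i).1 - ((eE x).2.1 i).2,
        fun i => ((eE x).2.2 i).1 + ((eE x).2.2 i).2))

/-- Appending a coordinate to the middle block of a triple product. -/
def prodConsEquiv (A Z L : Type*) [AddCommGroup A] [AddCommGroup Z] [AddCommGroup L] (k : ℕ) :
    ((A × (Fin k → Z) × L) × Z) ≃ₗ[ℤ] A × (Fin (k + 1) → Z) × L :=
  AddEquiv.toIntLinearEquiv
    { toFun := fun p => (p.1.1, Fin.cons p.2 p.1.2.1, p.1.2.2)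
      invFun := fun p => ((p.1, Fin.tail p.2.1, p.2.2), p.2.1 0)
      left_inv := fun p => by simp
      right_inv := fun p => by simp
      map_add' := fun p q => by
        refine Prod.ext rfl (Prod.ext (funext fun i => ?_) rfl)
        refine Fin.cases ?_ (fun i => ?_) i <;> simp }

theorem prodConsEquiv_apply {A Z L : Type*} [AddCommGroup A] [AddCommGroup Z] [AddCommGroup L]
    {k : ℕ} (p : (A × (Fin k → Z) × L) × Z) :
    prodConsEquiv A Z L k p = (p.1.1, Fin.cons p.2 p.1.2.1, p.1.2.2) := rfl

/-- Adding one copy of `0 → ℤ[1] → ℤ[τ] → ℤ[−1] → 0` preserves decomposability. -/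
theorem HasElementaryDecomposition.of_prod {M E N M' E' N' : Type*}
    [AddCommGroup M] [AddCommGroup E] [AddCommGroup N]
    [AddCommGroup M'] [AddCommGroup E'] [AddCommGroup N']
    {τM : M →ₗ[ℤ] M} {τE : E →ₗ[ℤ] E} {τN : N →ₗ[ℤ] N} {ι : M →ₗ[ℤ] E} {π : E →ₗ[ℤ] N}
    {τM' : M' →ₗ[ℤ] M'} {τE' : E' →ₗ[ℤ] E'} {τN' : N' →ₗ[ℤ] N'}
    {ι' : M' →ₗ[ℤ] E'} {π' : E' →ₗ[ℤ] N'}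
    (h : HasElementaryDecomposition τM' τE' τN' ι' π')
    (cM : M ≃ₗ[ℤ] M' × ℤ) (cE : E ≃ₗ[ℤ] E' × ℤ × ℤ) (cN : N ≃ₗ[ℤ] N' × ℤ)
    (hcM : ∀ m, cM (τM m) = (τM' (cM m).1, (cM m).2))
    (hcE : ∀ x, cE (τE x) = (τE' (cE x).1, (cE x).2.swap))
    (hcN : ∀ y, cN (τN y) = (τN' (cN y).1, -(cN y).2))
    (hι : ∀ m, cE (ι m) = (ι' (cM m).1, ((cM m).2, (cM m).2)))
    (hπ : ∀ x, cN (π x) = (π' (cE x).1, (cE x).2.1 - (cE x).2.2)) :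
    HasElementaryDecomposition τM τE τN ι π := by
  obtain ⟨k, l, a, b, σM, σN, eM, eE, eN, h1, h2, h3, h4, h5, h6, h7⟩ := h
  refine ⟨k + 1, l, a, b, σM, σN,
    cM ≪≫ₗ (eM.prodCongr (LinearEquiv.refl ℤ ℤ)) ≪≫ₗ prodConsEquiv _ _ _ k,
    cE ≪≫ₗ (eE.prodCongr (LinearEquiv.refl ℤ (ℤ × ℤ))) ≪≫ₗ prodConsEquiv _ _ _ k,
    cN ≪≫ₗ (eN.prodCongr (LinearEquiv.refl ℤ ℤ)) ≪≫ₗ prodConsEquiv _ _ _ k,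
    h1, h2, fun m => ?_, fun x => ?_, fun y => ?_, fun m => ?_, fun x => ?_⟩ <;>
  simp only [LinearEquiv.trans_apply, LinearEquiv.prodCongr_apply, prodConsEquiv_apply,
    LinearEquiv.refl_apply, hcM, hcE, hcN, hι, hπ, h3, h4, h5, h6, h7] <;>
  refine Prod.ext rfl (Prod.ext (funext fun i => ?_) rfl) <;>
  refine Fin.cases ?_ (fun i => ?_) i <;> simp

/-- Swapping the last two factors and twisting the last one. -/
def prodSwapEquiv (A Z : Type*) [AddCommGroup A] [AddCommGroup Z] (k l : ℕ) (ν : Z ≃+ Z) :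
    (A × (Fin k → Z) × (Fin l → Z)) ≃ₗ[ℤ] A × (Fin l → Z) × (Fin k → Z) :=
  AddEquiv.toIntLinearEquiv
    { toFun := fun p => (p.1, fun i => ν (p.2.2 i), fun i => ν (p.2.1 i))
      invFun := fun p => (p.1, fun i => ν.symm (p.2.2 i), fun i => ν.symm (p.2.1 i))
      left_inv := fun p => by simp
      right_inv := fun p => by simp
      map_add' := fun p q => by
        refine Prod.ext rfl (Prod.ext (funext fun i => ?_) (funext fun i => ?_)) <;> simp }

theorem prodSwapEquiv_apply {A Z : Type*} [AddCommGroup A] [AddCommGroup Z] {k l : ℕ} (ν : Z ≃+ Z)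
    (p : A × (Fin k → Z) × (Fin l → Z)) :
    prodSwapEquiv A Z k l ν p = (p.1, fun i => ν (p.2.2 i), fun i => ν (p.2.1 i)) := rfl

/-- Decomposability does not change when all the involutions are negated. -/
theorem HasElementaryDecomposition.of_neg {M E N : Type*}
    [AddCommGroup M] [AddCommGroup E] [AddCommGroup N]
    {τM : M →ₗ[ℤ] M} {τE : E →ₗ[ℤ] E} {τN : N →ₗ[ℤ] N} {ι : M →ₗ[ℤ] E} {π : E →ₗ[ℤ] N}
    (h : HasElementaryDecomposition (-τM) (-τE) (-τN) ι π) :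
    HasElementaryDecomposition τM τE τN ι π := by
  obtain ⟨k, l, a, b, σM, σN, eM, eE, eN, h1, h2, h3, h4, h5, h6, h7⟩ := h
  have hM : ∀ m, eM (τM m) = -eM ((-τM) m) := fun m => by simp
  have hE : ∀ x, eE (τE x) = -eE ((-τE) x) := fun x => by simp
  have hN : ∀ y, eN (τN y) = -eN ((-τN) y) := fun y => by simp
  let ν : ℤ × ℤ ≃+ ℤ × ℤ := (AddEquiv.refl ℤ).prodCongr (AddEquiv.neg ℤ)
  have hν : ∀ p, ν p = (p.1, -p.2) := fun p => rfl
  refine ⟨l, k, a, b, -σM, -σN,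
    eM ≪≫ₗ prodSwapEquiv _ _ k l (AddEquiv.refl ℤ),
    eE ≪≫ₗ prodSwapEquiv _ _ k l ν,
    eN ≪≫ₗ prodSwapEquiv _ _ k l (AddEquiv.refl ℤ),
    fun x => by simp [h1], fun x => by simp [h2],
    fun m => ?_, fun x => ?_, fun y => ?_, fun m => ?_, fun x => ?_⟩ <;>
  simp only [LinearEquiv.trans_apply, prodSwapEquiv_apply, hM, hE, hN, h3, h4, h5, h6, h7] <;>
  refine Prod.ext ?_ (Prod.ext (funext fun i => ?_) (funext fun i => ?_)) <;>
  simp [hν, sub_eq_add_neg]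

/-- An equivariantly split sequence is decomposable, with no elementary non-split summand. -/
theorem HasElementaryDecomposition.of_section {M E N : Type*}
    [AddCommGroup M] [AddCommGroup E] [AddCommGroup N]
    [Module.Free ℤ M] [Module.Finite ℤ M] [Module.Free ℤ N] [Module.Finite ℤ N]
    {τM : M →ₗ[ℤ] M} {τE : E →ₗ[ℤ] E} {τN : N →ₗ[ℤ] N} {ι : M →ₗ[ℤ] E} {π : E →ₗ[ℤ] N}
    (h : IsInvolutiveSES τM τE τN ι π) (s : N →ₗ[ℤ] E) (hs : ∀ n, π (s n) = n)
    (hsτ : ∀ n, s (τN n) = τE (s n)) :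
    HasElementaryDecomposition τM τE τN ι π := by
  have hbij : Function.Bijective (ι.coprod s) := by
    constructor
    · rw [← LinearMap.ker_eq_bot, LinearMap.ker_eq_bot']
      rintro ⟨m, n⟩ hmn
      simp only [LinearMap.coprod_apply] at hmn
      have hn : n = 0 := by simpa [h.comp_zero, hs] using congrArg π hmn
      subst hn
      have hm : m = 0 := h.inj (by simpa using hmn)
      rw [hm]; rfl
    · intro x
      obtain ⟨m, hm⟩ := h.exact (x - s (π x)) (by simp [hs])
      exact ⟨(m, π x), by simp [hm]⟩
  let c := (LinearEquiv.ofBijective _ hbij).symm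
  have hc : ∀ m n, c (ι m + s n) = (m, n) := fun m n =>
    (LinearEquiv.ofBijective _ hbij).symm_apply_apply (m, n)
  have hrep : ∀ x, ∃ m n, ι m + s n = x := fun x =>
    let ⟨p, hp⟩ := hbij.2 x
    ⟨p.1, p.2, hp⟩
  let fM := (Module.finBasis ℤ M).equivFun
  let fN := (Module.finBasis ℤ N).equivFun
  let u (X : Type) [AddCommGroup X] (A : Type) [AddCommGroup A] :
      A ≃ₗ[ℤ] A × (Fin 0 → X) × (Fin 0 → X) :=
    AddEquiv.toIntLinearEquiv
      { toFun := fun p => (p, 0, 0)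
        invFun := fun p => p.1
        left_inv := fun p => rfl
        right_inv := fun p => Prod.ext rfl (Subsingleton.elim _ _)
        map_add' := fun p q => Prod.ext rfl (Subsingleton.elim _ _) }
  have hu : ∀ (X : Type) [AddCommGroup X] (A : Type) [AddCommGroup A] (p : A),
      u X A p = (p, 0, 0) := fun X _ A _ p => rfl
  refine ⟨0, 0, _, _, fM.toLinearMap ∘ₗ τM ∘ₗ fM.symm.toLinearMap,
    fN.toLinearMap ∘ₗ τN ∘ₗ fN.symm.toLinearMap, fM ≪≫ₗ u _ _,
    c ≪≫ₗ (fM.prodCongr fN) ≪≫ₗ u _ _, fN ≪≫ₗ u _ _,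
    fun x => by simp [h.involM], fun x => by simp [h.involN],
    fun m => Prod.ext ?_ (Subsingleton.elim _ _), fun x => Prod.ext ?_ (Subsingleton.elim _ _),
    fun y => Prod.ext ?_ (Subsingleton.elim _ _), fun m => Prod.ext ?_ (Subsingleton.elim _ _),
    fun x => Prod.ext ?_ (Subsingleton.elim _ _)⟩
  · simp [hu]
  · obtain ⟨m, n, rfl⟩ := hrep x
    simp [hu, -map_add, hc]
    simp [← h.map_ι, ← hsτ, hc]
  · simp [hu]
  · have := hc m 0
    rw [map_zero, add_zero] at this
    simp [hu, this]
  · obtain ⟨m, n, rfl⟩ := hrep x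
    simp [hu, -map_add, hc]
    simp [h.comp_zero, hs]

/-- The decomposition of a group along a split surjection. -/
def LinearMap.kerProdEquivOfSection {M P : Type*} [AddCommGroup M] [AddCommGroup P]
    (f : M →ₗ[ℤ] P) (s : P →ₗ[ℤ] M) (h : ∀ p, f (s p) = p) : M ≃ₗ[ℤ] LinearMap.ker f × P :=
  AddEquiv.toIntLinearEquiv
    { toFun := fun x => (⟨x - s (f x), by simp [h]⟩, f x)
      invFun := fun p => p.1 + s p.2
      left_inv := fun x => by simp
      right_inv := fun p => by
        have := p.1.2
        rw [LinearMap.mem_ker] at this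
        ext <;> simp [h, this]
      map_add' := fun x y => by
        ext
        · simp only [map_add, Prod.fst_add, Submodule.coe_add]
          abel
        · simp }

theorem LinearMap.kerProdEquivOfSection_apply {M P : Type*} [AddCommGroup M] [AddCommGroup P]
    (f : M →ₗ[ℤ] P) (s : P →ₗ[ℤ] M) (h : ∀ p, f (s p) = p) (x : M) :
    f.kerProdEquivOfSection s h x = (⟨x - s (f x), by simp [h]⟩, f x) := rfl

/-- Splitting off one copy of `0 → ℤ[1] → ℤ[τ] → ℤ[−1] → 0`. -/
theorem HasElementaryDecomposition.of_functional {M E N : Type*}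
    [AddCommGroup M] [AddCommGroup E] [AddCommGroup N] [Module.Free ℤ N] [Module.Finite ℤ N]
    {τM : M →ₗ[ℤ] M} {τE : E →ₗ[ℤ] E} {τN : N →ₗ[ℤ] N} {ι : M →ₗ[ℤ] E} {π : E →ₗ[ℤ] N}
    (h : IsInvolutiveSES τM τE τN ι π) (F : E →ₗ[ℤ] ℤ) (e : E)
    (hFe : F e = 1) (hFτe : F (τE e) = 0) (hF : ∀ m, F (ι (τM m)) = F (ι m))
    (he : τN (π e) = -π e)
    (ih : ∀ (M' : Submodule ℤ M) (E' : Submodule ℤ E) (N' : Submodule ℤ N)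
      (τM' : M' →ₗ[ℤ] M') (τE' : E' →ₗ[ℤ] E') (τN' : N' →ₗ[ℤ] N')
      (ι' : M' →ₗ[ℤ] E') (π' : E' →ₗ[ℤ] N'),
      Module.finrank ℤ N = Module.finrank ℤ N' + 1 → IsInvolutiveSES τM' τE' τN' ι' π' →
      HasElementaryDecomposition τM' τE' τN' ι' π') :
    HasElementaryDecomposition τM τE τN ι π := by
  obtain ⟨m₀, hm₀⟩ := h.exact (e + τE e) (by simp [h.map_π, he])
  have hτm₀ : τM m₀ = m₀ := h.inj (by rw [h.map_ι, hm₀, map_add, h.involE, add_comm])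
  obtain ⟨s, hs⟩ := Module.projective_lifting_property π LinearMap.id h.surj
  replace hs : ∀ n, π (s n) = n := LinearMap.congr_fun hs
  let f : M →ₗ[ℤ] ℤ := F ∘ₗ ι
  let fE : E →ₗ[ℤ] ℤ × ℤ := F.prod (F ∘ₗ τE)
  let g : N →ₗ[ℤ] ℤ := (F - F ∘ₗ τE) ∘ₗ s
  have hf : ∀ m, f m = F (ι m) := fun m => rfl
  have hfE : ∀ x, fE x = (F x, F (τE x)) := fun x => rfl
  have hg : ∀ x, g (π x) = F x - F (τE x) := fun x => by
    obtain ⟨m, hm⟩ := h.exact (x - s (π x)) (by simp [hs])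
    have h1 : F (τE (ι m)) = F (ι m) := by rw [← h.map_ι, hF]
    rw [hm, map_sub, map_sub, map_sub] at h1
    change F (s (π x)) - F (τE (s (π x))) = _
    linarith
  have hgτ : ∀ y, g (τN y) = -g y := fun y => by
    obtain ⟨x, rfl⟩ := h.surj y
    rw [← h.map_π, hg, hg, h.involE]
    ring
  let sM : ℤ →ₗ[ℤ] M := LinearMap.toSpanSingleton ℤ M m₀
  let sE : ℤ × ℤ →ₗ[ℤ] E :=
    (LinearMap.toSpanSingleton ℤ E e).coprod (LinearMap.toSpanSingleton ℤ E (τE e))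
  let sN : ℤ →ₗ[ℤ] N := LinearMap.toSpanSingleton ℤ N (π e)
  have hsM : ∀ a, sM a = a • m₀ := fun a => rfl
  have hsE : ∀ a, sE a = a.1 • e + a.2 • τE e := fun a => rfl
  have hsN : ∀ a, sN a = a • π e := fun a => rfl
  have hfsM : ∀ a, f (sM a) = a := fun a => by simp [hsM, hf, hm₀, hFe, hFτe]
  have hfsE : ∀ a, fE (sE a) = a := fun a => by simp [hsE, hfE, hFe, hFτe, h.involE]
  have hgsN : ∀ a, g (sN a) = a := fun a => by simp [hsN, hg, hFe, hFτe]
  let τM' : LinearMap.ker f →ₗ[ℤ] LinearMap.ker f := τM.restrict fun m hm => by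
    rw [LinearMap.mem_ker] at hm ⊢
    rw [hf, hF, ← hf, hm]
  let τE' : LinearMap.ker fE →ₗ[ℤ] LinearMap.ker fE := τE.restrict fun x hx => by
    rw [LinearMap.mem_ker, hfE, Prod.mk_eq_zero] at hx ⊢
    rw [h.involE]
    exact hx.symm
  let τN' : LinearMap.ker g →ₗ[ℤ] LinearMap.ker g := τN.restrict fun y hy => by
    rw [LinearMap.mem_ker] at hy ⊢
    rw [hgτ, hy, neg_zero]
  let ι' : LinearMap.ker f →ₗ[ℤ] LinearMap.ker fE := ι.restrict fun m hm => by
    rw [LinearMap.mem_ker, hf] at hm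
    rw [LinearMap.mem_ker, hfE, ← h.map_ι, hF, hm]
    rfl
  let π' : LinearMap.ker fE →ₗ[ℤ] LinearMap.ker g := π.restrict fun x hx => by
    rw [LinearMap.mem_ker, hfE, Prod.mk_eq_zero] at hx
    rw [LinearMap.mem_ker, hg, hx.1, hx.2, sub_zero]
  have hses : IsInvolutiveSES τM' τE' τN' ι' π' :=
    { involM := fun x => Subtype.ext (h.involM x)
      involE := fun x => Subtype.ext (h.involE x)
      involN := fun x => Subtype.ext (h.involN x)
      map_ι := fun x => Subtype.ext (h.map_ι x)
      map_π := fun x => Subtype.ext (h.map_π x)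
      inj := fun x y hxy => Subtype.ext (h.inj (congrArg Subtype.val hxy))
      surj := fun y => by
        obtain ⟨x, hx⟩ := h.surj y
        have hgy := y.2
        rw [LinearMap.mem_ker, ← hx, hg, sub_eq_zero] at hgy
        refine ⟨⟨x - sE (fE x), by rw [LinearMap.mem_ker, map_sub, hfsE, sub_self]⟩, ?_⟩
        refine Subtype.ext ?_
        change π (x - sE (fE x)) = y
        simp [hsE, hfE, hgy, h.map_π, he, hx]
      comp_zero := fun x => Subtype.ext (h.comp_zero x)
      exact := fun x hx => by
        obtain ⟨m, hm⟩ := h.exact x (congrArg Subtype.val hx)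
        have hfx := x.2
        rw [LinearMap.mem_ker, hfE, Prod.mk_eq_zero] at hfx
        refine ⟨⟨m, ?_⟩, Subtype.ext hm⟩
        rw [LinearMap.mem_ker, hf, hm, hfx.1] }
  have hrank : Module.finrank ℤ N = Module.finrank ℤ (LinearMap.ker g) + 1 := by
    rw [(g.kerProdEquivOfSection sN hgsN).finrank_eq, Module.finrank_prod, Module.finrank_self]
  refine (ih _ _ _ _ _ _ _ _ hrank hses).of_prod (f.kerProdEquivOfSection sM hfsM)
    (fE.kerProdEquivOfSection sE hfsE) (g.kerProdEquivOfSection sN hgsN)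
    (fun m => ?_) (fun x => ?_) (fun y => ?_) (fun m => ?_) (fun x => ?_) <;>
  simp only [LinearMap.kerProdEquivOfSection_apply] <;>
  refine Prod.ext (Subtype.ext ?_) ?_
  · change _ = τM (m - sM (f m))
    simp [hsM, hf, hF, hτm₀]
  · simp [hf, hF]
  · change _ = τE (x - sE (fE x))
    simp [hsE, hfE, h.involE, add_comm]
  · simp [hfE, h.involE]
  · change _ = τN (y - sN (g y))
    simp [hsN, hgτ, he]
  · simp [hgτ]
  · change _ = ι (m - sM (f m))
    simp [hsM, hsE, hf, hfE, hm₀, ← h.map_ι, hF]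
  · simp [hf, hfE, ← h.map_ι, hF]
  · change _ = π (x - sE (fE x))
    simp only [hsN, hsE, hg, hfE, map_sub, map_add, map_smul, h.map_π, he]
    module
  · simp [hg, hfE]

/-- An anti-invariant element without anti-invariant lift yields the data that splits off a copy
of `0 → ℤ[1] → ℤ[τ] → ℤ[−1] → 0`. -/
theorem IsInvolutiveSES.exists_functional {M E N : Type*}
    [AddCommGroup M] [AddCommGroup E] [AddCommGroup N]
    [Module.Free ℤ M] [Module.Free ℤ N] [Module.Finite ℤ N]
    {τM : M →ₗ[ℤ] M} {τE : E →ₗ[ℤ] E} {τN : N →ₗ[ℤ] N} {ι : M →ₗ[ℤ] E} {π : E →ₗ[ℤ] N}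
    (h : IsInvolutiveSES τM τE τN ι π) (n : N) (hn : τN n = -n)
    (hlift : ∀ e, π e = n → τE e ≠ -e) :
    ∃ (F : E →ₗ[ℤ] ℤ) (e : E), F e = 1 ∧ F (τE e) = 0 ∧ (∀ m, F (ι (τM m)) = F (ι m)) ∧
      τN (π e) = -π e := by
  obtain ⟨s, hs⟩ := Module.projective_lifting_property π LinearMap.id h.surj
  replace hs : ∀ n, π (s n) = n := LinearMap.congr_fun hs
  obtain ⟨r, hr⟩ : ∃ r : E →ₗ[ℤ] M, ∀ m, r (ι m) = m := by
    have hx : ∀ x, x - s (π x) ∈ LinearMap.range ι := fun x => h.exact _ (by simp [hs])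
    refine ⟨(LinearEquiv.ofInjective ι h.inj).symm.toLinearMap ∘ₗ
      (LinearMap.id - s ∘ₗ π).codRestrict _ hx, fun m => ?_⟩
    refine (LinearEquiv.symm_apply_eq _).2 (Subtype.ext ?_)
    simp [h.comp_zero]
  have hn0 : n ≠ 0 := by
    rintro rfl
    exact hlift 0 (map_zero π) (by simp)
  obtain ⟨d, n', p, hd, rfl, hp⟩ := exists_primitive_vector n hn0
  replace hn : τN n' = -n' := by
    rw [map_smul, ← smul_neg] at hn
    exact smul_right_injective N hd hn
  obtain ⟨e₀, rfl⟩ := h.surj n'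
  obtain ⟨m₀, hm₀⟩ := h.exact (e₀ + τE e₀) (by simp [h.map_π, hn])
  have hτm₀ : τM m₀ = m₀ := h.inj (by rw [h.map_ι, hm₀, map_add, h.involE, add_comm])
  let T : M × M →ₗ[ℤ] M :=
    (LinearMap.id + τM).coprod (LinearMap.id + LinearMap.id)
  have hT : ∀ y z, T (y, z) = (y + τM y) + (z + z) := fun y z => rfl
  have hm₀T : m₀ ∉ LinearMap.range T := by
    rintro ⟨⟨y, z⟩, hyz⟩
    rw [hT] at hyz
    have h2 : m₀ = (y + z) + τM (y + z) := by
      refine smul_right_injective M (two_ne_zero (α := ℤ)) ?_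
      have h3 : (2 : ℤ) • m₀ = m₀ + τM m₀ := by rw [hτm₀, two_smul]
      dsimp only
      rw [h3, ← hyz]
      simp only [map_add, h.involM]
      module
    refine hlift (d • (e₀ - ι (y + z))) (by simp [h.comp_zero]) ?_
    have h4 : τE e₀ = ι ((y + z) + τM (y + z)) - e₀ := by rw [← h2, hm₀]; abel
    rw [map_smul, map_sub, h4, ← h.map_ι, ← smul_neg, map_add ι]
    congr 1
    abel
  obtain ⟨g, hgeven, hgodd⟩ := exists_functional_even_odd (LinearMap.range T)
    (fun x => ⟨(0, x), by simp [hT]⟩) m₀ hm₀T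
  obtain ⟨f₀, hf₀⟩ := Module.Projective.exists_lift_of_forall_exists
    (LinearMap.toSpanSingleton ℤ ℤ 2) (g + g ∘ₗ τM) (fun x => by
      obtain ⟨c, hc⟩ := hgeven (x + τM x) ⟨(x, 0), by simp [hT]⟩
      exact ⟨c, by simpa [mul_two] using hc.symm⟩)
  replace hf₀ : ∀ x, 2 * f₀ x = g x + g (τM x) := fun x => by
    have := hf₀ x
    simpa [mul_comm] using this
  have hf₀m₀ : f₀ m₀ = g m₀ := by
    have := hf₀ m₀
    rw [hτm₀] at this
    linarith
  have hf₀τ : ∀ x, f₀ (τM x) = f₀ x := fun x => by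
    have h1 := hf₀ x
    have h2 := hf₀ (τM x)
    rw [h.involM] at h2
    linarith
  have hf₀0 : f₀ ≠ 0 := by
    rintro rfl
    rw [← hf₀m₀] at hgodd
    simp at hgodd
  obtain ⟨c, f, m₁, hc, hf, hm₁⟩ := exists_primitive_functional f₀ hf₀0
  have hfτ : ∀ x, f (τM x) = f x := fun x => by
    have := hf₀τ x
    rw [hf, hf] at this
    exact mul_left_cancel₀ hc this
  obtain ⟨t, ht⟩ : Odd (f m₀) := by
    rw [← hf₀m₀, hf] at hgodd
    exact (Int.odd_mul.1 hgodd).2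
  let e := e₀ - ι (t • m₁)
  have hπe : π e = π e₀ := by simp [e, h.comp_zero]
  have hfe : f (r e) + f (r (τE e)) = 1 := by
    have : e + τE e = ι (m₀ - t • m₁ - t • τM m₁) := by
      have h4 : τE e₀ = ι m₀ - e₀ := by rw [hm₀]; abel
      simp only [e, map_sub, h4, ← h.map_ι, map_smul]
      abel
    rw [← map_add, ← map_add, this, hr]
    simp only [map_sub, map_smul, hfτ, hm₁, ht, smul_eq_mul]
    ring
  refine ⟨f ∘ₗ r + f (r (τE e)) • (p ∘ₗ π), e, ?_, ?_, fun m => ?_, ?_⟩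
  · simp [hπe, hp, hfe]
  · simp [h.map_π, hπe, hn, hp]
  · simp [hr, hfτ, h.comp_zero]
  · rw [hπe, hn]

theorem add_self_injective_of_free {A : Type*} [AddCommGroup A] [Module.Free ℤ A] {a b : A}
    (h : a + a = b + b) : a = b :=
  smul_right_injective A (two_ne_zero (α := ℤ)) (by simpa [two_smul] using h)

/-- The reduction `A / 2 • A` of an abelian group. -/
abbrev ModTwo (A : Type*) [AddCommGroup A] : Type _ :=
  A ⧸ LinearMap.range (LinearMap.id + LinearMap.id : A →ₗ[ℤ] A)

namespace ModTwo

variable {A B : Type*} [AddCommGroup A] [AddCommGroup B]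

/-- The reduction map `A → A / 2 • A`. -/
def mk : A →ₗ[ℤ] ModTwo A := Submodule.mkQ _

theorem mk_surjective : Function.Surjective (mk : A → ModTwo A) := Submodule.mkQ_surjective _

theorem mk_eq_zero_iff {a : A} : mk a = 0 ↔ ∃ y, y + y = a := Submodule.Quotient.mk_eq_zero _

theorem mk_eq_mk_of_sub_eq {a b : A} (y : A) (h : y + y = a - b) : mk a = mk b := by
  rw [← sub_eq_zero, ← map_sub]
  exact mk_eq_zero_iff.2 ⟨y, h⟩

instance : Module (ZMod 2) (ModTwo A) := AddCommGroup.zmodModule fun x => by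
  obtain ⟨x, rfl⟩ := mk_surjective x
  rw [two_nsmul, ← map_add]
  exact mk_eq_zero_iff.2 ⟨x, rfl⟩

/-- The map induced on reductions modulo `2`. -/
def map (f : A →ₗ[ℤ] B) : ModTwo A →ₗ[ZMod 2] ModTwo B :=
  AddMonoidHom.toZModLinearMap 2 (Submodule.mapQ _ _ f (by
    rintro _ ⟨y, rfl⟩
    exact ⟨f y, (map_add f y y).symm⟩)).toAddMonoidHom

theorem map_mk (f : A →ₗ[ℤ] B) (a : A) : map f (mk a) = mk (f a) := rfl

end ModTwo

/-- If invariant and anti-invariant elements lift to such elements, the sequence splits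
equivariantly. -/
theorem IsInvolutiveSES.exists_section {M E N : Type*}
    [AddCommGroup M] [AddCommGroup E] [AddCommGroup N]
    [Module.Free ℤ M] [Module.Free ℤ N]
    {τM : M →ₗ[ℤ] M} {τE : E →ₗ[ℤ] E} {τN : N →ₗ[ℤ] N} {ι : M →ₗ[ℤ] E} {π : E →ₗ[ℤ] N}
    (h : IsInvolutiveSES τM τE τN ι π)
    (hpos : ∀ n, τN n = n → ∃ e, π e = n ∧ τE e = e)
    (hneg : ∀ n, τN n = -n → ∃ e, π e = n ∧ τE e = -e) :
    ∃ s : N →ₗ[ℤ] E, (∀ n, π (s n) = n) ∧ ∀ n, s (τN n) = τE (s n) := by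
  obtain ⟨s, hs⟩ := Module.projective_lifting_property π LinearMap.id h.surj
  replace hs : ∀ n, π (s n) = n := LinearMap.congr_fun hs
  obtain ⟨ψ, hψ⟩ := Module.Projective.exists_lift_of_forall_exists ι (τE ∘ₗ s - s ∘ₗ τN)
    (fun n => h.exact _ (by simp [h.map_π, hs]))
  replace hψ : ∀ n, ι (ψ n) = τE (s n) - s (τN n) := hψ
  have hψτ : ∀ n, ψ (τN n) = -τM (ψ n) := fun n => h.inj (by
    rw [map_neg, h.map_ι, hψ, hψ, map_sub, h.involE, h.involN]; abel)
  have hcob : ∀ n, τN n = n → ∃ m, ψ n = m - τM m := fun n hn => by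
    obtain ⟨e, he, hτe⟩ := hpos n hn
    obtain ⟨m, hm⟩ := h.exact (e - s n) (by simp [he, hs])
    refine ⟨m, h.inj ?_⟩
    rw [hψ, hn, map_sub, h.map_ι, hm, map_sub, hτe]
    abel
  have hcob' : ∀ n, τN n = -n → ∃ m, ψ n = -(m + τM m) := fun n hn => by
    obtain ⟨e, he, hτe⟩ := hneg n hn
    obtain ⟨m, hm⟩ := h.exact (e - s n) (by simp [he, hs])
    refine ⟨m, h.inj ?_⟩
    rw [hψ, hn, map_neg, map_neg, map_add, h.map_ι, hm, map_sub, hτe]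
    abel
  obtain ⟨hbar, hhbar⟩ := LinearMap.exists_eq_comp_add_comp
    (ModTwo.map (LinearMap.id + τN)) (ModTwo.map (LinearMap.id + τM)) (ModTwo.map ψ)
    (fun v => by
      obtain ⟨n, rfl⟩ := ModTwo.mk_surjective v
      simp only [ModTwo.map_mk, ModTwo.mk_eq_zero_iff]
      refine ⟨n + τN n, ?_⟩
      simp only [LinearMap.add_apply, LinearMap.id_apply, map_add, h.involN]
      abel)
    (fun v => by
      obtain ⟨n, rfl⟩ := ModTwo.mk_surjective v
      simp only [ModTwo.map_mk]
      refine ModTwo.mk_eq_mk_of_sub_eq (-τM (ψ n)) ?_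
      simp only [LinearMap.add_apply, LinearMap.id_apply, map_add, hψτ]
      abel)
    (fun v hv => by
      obtain ⟨n, rfl⟩ := ModTwo.mk_surjective v
      rw [ModTwo.map_mk, ModTwo.mk_eq_zero_iff] at hv
      obtain ⟨n', hn'⟩ := hv
      simp only [LinearMap.add_apply, LinearMap.id_apply] at hn'
      have hτn' : τN n' = n' := add_self_injective_of_free (by
        rw [← map_add, hn', map_add, h.involN, add_comm])
      have hτn : τN n = n' + n' - n := by rw [hn']; abel
      obtain ⟨m₁, hm₁⟩ := hcob n' hτn'
      obtain ⟨m₂, hm₂⟩ := hcob' (n - n') (by rw [map_sub, hτn', hτn]; abel)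
      refine ⟨ModTwo.mk (m₁ - m₂), ?_⟩
      simp only [ModTwo.map_mk]
      refine ModTwo.mk_eq_mk_of_sub_eq (τM m₁) ?_
      rw [← sub_add_cancel n n', map_add, hm₁, hm₂]
      simp only [LinearMap.add_apply, LinearMap.id_apply, map_sub]
      abel)
  obtain ⟨k, hk⟩ := Module.Projective.exists_lift_of_forall_exists
    (ModTwo.mk : M →ₗ[ℤ] ModTwo M) (hbar.toAddMonoidHom.toIntLinearMap ∘ₗ ModTwo.mk)
    (fun n => ModTwo.mk_surjective _)
  replace hk : ∀ n, hbar (ModTwo.mk n) = ModTwo.mk (k n) := fun n => (hk n).symm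
  obtain ⟨y, hy⟩ := Module.Projective.exists_lift_of_forall_exists
    (LinearMap.id + LinearMap.id : M →ₗ[ℤ] M) (ψ - (k ∘ₗ τN - τM ∘ₗ k)) (fun n => by
      have hn := hhbar (ModTwo.mk n)
      simp only [ModTwo.map_mk, hk] at hn
      rw [← map_add, ← sub_eq_zero, ← map_sub, ModTwo.mk_eq_zero_iff] at hn
      obtain ⟨z, hz⟩ := hn
      refine ⟨z + k n + τM (k n), ?_⟩
      have hψn := eq_add_of_sub_eq hz.symm
      simp only [LinearMap.add_apply, LinearMap.id_apply, LinearMap.sub_apply,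
        LinearMap.comp_apply, map_add] at hψn ⊢
      rw [hψn]
      abel)
  replace hy : ∀ n, y n + y n = ψ n - (k (τN n) - τM (k n)) := hy
  have hyτ : ∀ n, y (τN n) = -τM (y n) := fun n => add_self_injective_of_free (by
    rw [hy, ← neg_add, ← map_add, hy, h.involN, hψτ]
    simp only [map_sub, h.involM]
    abel)
  refine ⟨s + ι ∘ₗ (k + y ∘ₗ τN), fun n => by simp [hs, h.comp_zero], fun n => ?_⟩
  have h1 : s (τN n) = τE (s n) - ι (ψ n) := by rw [hψ]; abel
  have h2 : ψ n = y n + y n + (k (τN n) - τM (k n)) := by rw [hy]; abel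
  simp only [LinearMap.add_apply, LinearMap.comp_apply, h1, h2, h.involN, hyτ, map_add, map_sub,
    map_neg, h.map_ι, h.involE]
  abel

/-- Negating all the involutions preserves short exact sequences. -/
theorem IsInvolutiveSES.neg {M E N : Type*}
    [AddCommGroup M] [AddCommGroup E] [AddCommGroup N]
    {τM : M →ₗ[ℤ] M} {τE : E →ₗ[ℤ] E} {τN : N →ₗ[ℤ] N} {ι : M →ₗ[ℤ] E} {π : E →ₗ[ℤ] N}
    (h : IsInvolutiveSES τM τE τN ι π) : IsInvolutiveSES (-τM) (-τE) (-τN) ι π where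
  involM x := by simp [h.involM]
  involE x := by simp [h.involE]
  involN x := by simp [h.involN]
  map_ι x := by simp [h.map_ι]
  map_π x := by simp [h.map_π]
  inj := h.inj
  surj := h.surj
  comp_zero := h.comp_zero
  exact := h.exact

/-- Every short exact sequence of lattices with involutions is decomposable. -/
theorem IsInvolutiveSES.hasElementaryDecomposition {M E N : Type*}
    [AddCommGroup M] [AddCommGroup E] [AddCommGroup N]
    [Module.Free ℤ M] [Module.Finite ℤ M] [Module.Free ℤ N] [Module.Finite ℤ N]
    {τM : M →ₗ[ℤ] M} {τE : E →ₗ[ℤ] E} {τN : N →ₗ[ℤ] N} {ι : M →ₗ[ℤ] E} {π : E →ₗ[ℤ] N}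
    (h : IsInvolutiveSES τM τE τN ι π) : HasElementaryDecomposition τM τE τN ι π := by
  induction hd : Module.finrank ℤ N generalizing M E N with
  | zero =>
    have : Subsingleton N := Module.finrank_zero_iff.1 hd
    exact .of_section h 0 (fun n => Subsingleton.elim _ _) (fun n => by simp)
  | succ d ih =>
    by_cases hneg : ∀ n, τN n = -n → ∃ e, π e = n ∧ τE e = -e
    · by_cases hpos : ∀ n, τN n = n → ∃ e, π e = n ∧ τE e = e
      · obtain ⟨s, hs, hsτ⟩ := h.exists_section hpos hneg
        exact .of_section h s hs hsτ
      · push Not at hpos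
        obtain ⟨n, hn, hlift⟩ := hpos
        obtain ⟨F, e, hFe, hFτe, hF, he⟩ := h.neg.exists_functional n (by simp [hn])
          (fun e he => by simpa using hlift e he)
        exact .of_neg (.of_functional h.neg F e hFe hFτe hF he
          fun M' E' N' τM' τE' τN' ι' π' hrank h' => ih h' (by omega))
    · push Not at hneg
      obtain ⟨n, hn, hlift⟩ := hneg
      obtain ⟨F, e, hFe, hFτe, hF, he⟩ := h.exists_functional n hn hlift
      exact .of_functional h F e hFe hFτe hF he
        fun M' E' N' τM' τE' τN' ι' π' hrank h' => ih h' (by omega)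


/-- **Decomposition of short exact sequences of ℤ[τ]-lattices.** Every short exact
sequence of ℤ[τ]-lattices is (equivariantly isomorphic to) the direct sum of a split
short exact sequence `0 → M₀ → M₀ ⊕ N₀ → N₀ → 0`, of `k` copies of the elementary
non-split sequence `0 → ℤ[1] → ℤ[τ] → ℤ[−1] → 0` (with maps `1 ↦ (1,1)` and
`(a,b) ↦ a − b`), and of `l` copies of the elementary non-split sequence
`0 → ℤ[−1] → ℤ[τ] → ℤ[1] → 0` (with maps `1 ↦ (1,−1)` and `(a,b) ↦ a + b`). -/
theorem stmt_6 {M E N : Type*}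
    [AddCommGroup M] [Module ℤ M] [Module.Free ℤ M] [Module.Finite ℤ M]
    [AddCommGroup E] [Module ℤ E] [Module.Free ℤ E] [Module.Finite ℤ E]
    [AddCommGroup N] [Module ℤ N] [Module.Free ℤ N] [Module.Finite ℤ N]
    (τM : M →ₗ[ℤ] M) (τE : E →ₗ[ℤ] E) (τN : N →ₗ[ℤ] N)
    (hM : ∀ x, τM (τM x) = x) (hE : ∀ x, τE (τE x) = x) (hN : ∀ x, τN (τN x) = x)
    (ι : M →ₗ[ℤ] E) (π : E →ₗ[ℤ] N)
    (hι : ∀ x, ι (τM x) = τE (ι x)) (hπ : ∀ x, π (τE x) = τN (π x))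
    (hinj : Function.Injective ι) (hsurj : Function.Surjective π)
    (hexact : LinearMap.range ι = LinearMap.ker π) :
    ∃ (k l a b : ℕ)
      (σM : (Fin a → ℤ) →ₗ[ℤ] (Fin a → ℤ)) (σN : (Fin b → ℤ) →ₗ[ℤ] (Fin b → ℤ))
      (eM : M ≃ₗ[ℤ] (Fin a → ℤ) × (Fin k → ℤ) × (Fin l → ℤ))
      (eE : E ≃ₗ[ℤ] ((Fin a → ℤ) × (Fin b → ℤ)) × (Fin k → ℤ × ℤ) × (Fin l → ℤ × ℤ))
      (eN : N ≃ₗ[ℤ] (Fin b → ℤ) × (Fin k → ℤ) × (Fin l → ℤ)),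
      (∀ x, σM (σM x) = x) ∧ (∀ x, σN (σN x) = x) ∧
      (∀ m : M, eM (τM m) = (σM (eM m).1, (eM m).2.1, -(eM m).2.2)) ∧
      (∀ x : E, eE (τE x) =
        ((σM (eE x).1.1, σN (eE x).1.2),
          fun i => ((eE x).2.1 i).swap, fun i => ((eE x).2.2 i).swap)) ∧
      (∀ y : N, eN (τN y) = (σN (eN y).1, -(eN y).2.1, (eN y).2.2)) ∧
      (∀ m : M, eE (ι m) =
        (((eM m).1, 0),
          fun i => ((eM m).2.1 i, (eM m).2.1 i),
          fun i => ((eM m).2.2 i, -(eM m).2.2 i))) ∧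
      (∀ x : E, eN (π x) =
        ((eE x).1.2,
          fun i => ((eE x).2.1 i).1 - ((eE x).2.1 i).2,
          fun i => ((eE x).2.2 i).1 + ((eE x).2.2 i).2)) := by
  obtain rfl : ‹Module ℤ M› = AddCommGroup.toIntModule M := Subsingleton.elim _ _
  obtain rfl : ‹Module ℤ E› = AddCommGroup.toIntModule E := Subsingleton.elim _ _
  obtain rfl : ‹Module ℤ N› = AddCommGroup.toIntModule N := Subsingleton.elim _ _
  exact IsInvolutiveSES.hasElementaryDecomposition
    { involM := hM
      involE := hE
      involN := hN
      map_ι := hι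
      map_π := hπ
      inj := hinj
      surj := hsurj
      comp_zero := fun x => by
        rw [← LinearMap.mem_ker, ← hexact]
        exact ⟨x, rfl⟩
      exact := fun x hx => by
        rw [← LinearMap.mem_ker, ← hexact] at hx
        exact hx }
end

section
/- Let (M, τ_M) and (N, τ_N) be ℤ[τ]-lattices. Call a ℤ-linear map d : N → M anti-equivariant if τ_M ∘ d ∘ τ_N = −d. Every anti-equivariant d maps ker(1+τ_N) into ker(1−τ_M) and im(1−τ_N) into im(1+τ_M), and maps ker(1−τ_N) into ker(1+τ_M) and im(1+τ_N) into im(1−τ_M); hence it induces homomorphisms d₁ : H¹(ℤ/2;N) → H²(ℤ/2;M) and d₂ : H²(ℤ/2;N) → H¹(ℤ/2;M). The anti-equivariant maps form a subgroup of Hom_ℤ(N, M) containing {τ_M ∘ m ∘ τ_N − m : m ∈ Hom_ℤ(N, M)} as a subgroup, and the induced map from the quotient {anti-equivariant d}/{τ_M ∘ m ∘ τ_N − m} to Hom(H¹(ℤ/2;N), H²(ℤ/2;M)) × Hom(H²(ℤ/2;N), H¹(ℤ/2;M)), sending [d] to (d₁, d₂), is a group isomorphism. -/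
/-- The cohomology quotient `ker f / (im g ∩ ker f)`; for an involution `τ`, taking
`f = 1+τ`, `g = 1−τ` gives `H¹(ℤ/2;·) = ker(1+τ)/im(1−τ)`, and `f = 1−τ`, `g = 1+τ`
gives `H²(ℤ/2;·) = ker(1−τ)/im(1+τ)`. -/
abbrev SubQuot {R N : Type*} [CommRing R] [AddCommGroup N] [Module R N]
    (f g : N →ₗ[R] N) :=
  ↥(LinearMap.ker f) ⧸ (LinearMap.range g).comap (LinearMap.ker f).subtype

/-- The natural projection `ker f → ker f / im g`. -/
abbrev SubQuot.mk {R N : Type*} [CommRing R] [AddCommGroup N] [Module R N]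
    {f g : N →ₗ[R] N} (x : ↥(LinearMap.ker f)) : SubQuot f g :=
  Submodule.Quotient.mk x

/-- The additive group of anti-equivariant maps `d : N → M`, i.e. those with
`τ_M ∘ d ∘ τ_N = −d`. -/
def antiSubgroup {M N : Type*} [AddCommGroup M] [Module ℤ M] [AddCommGroup N] [Module ℤ N]
    (τM : M →ₗ[ℤ] M) (τN : N →ₗ[ℤ] N) : AddSubgroup (N →ₗ[ℤ] M) where
  carrier := {d | ∀ y, τM (d (τN y)) = - d y}
  zero_mem' := by intro y; simp
  add_mem' := by
    intro a b ha hb y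
    simp only [LinearMap.add_apply, map_add, ha y, hb y]
    abel
  neg_mem' := by
    intro a ha y
    simp only [LinearMap.neg_apply, map_neg, ha y, neg_neg]

/-- The coboundary homomorphism `m ↦ τ_M ∘ m ∘ τ_N − m` on `Hom_ℤ(N, M)`. -/
def coboundary {M N : Type*} [AddCommGroup M] [Module ℤ M] [AddCommGroup N] [Module ℤ N]
    (τM : M →ₗ[ℤ] M) (τN : N →ₗ[ℤ] N) : (N →ₗ[ℤ] M) →+ (N →ₗ[ℤ] M) where
  toFun m := τM ∘ₗ m ∘ₗ τN - m
  map_zero' := by simp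
  map_add' a b := by
    ext y
    simp only [LinearMap.sub_apply, LinearMap.add_apply, LinearMap.comp_apply, map_add]
    abel

section Involution

variable {N : Type*} [AddCommGroup N]

/-- The additive group of endomorphisms of `(N, τ)` generated by those that factor through a
rank-one lattice on which the involution is `±1`, and by the norms `h + τ h τ`. -/
def rankOneOrNorm (τ : N →ₗ[ℤ] N) : AddSubgroup (N →ₗ[ℤ] N) :=
  AddSubgroup.closure
    ({f | ∃ (α : N →ₗ[ℤ] ℤ) (a : N), f = α.smulRight a ∧
        (((∀ x, α (τ x) = α x) ∧ τ a = a) ∨ ((∀ x, α (τ x) = -α x) ∧ τ a = -a))} ∪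
      {f | ∃ h : N →ₗ[ℤ] N, f = h + τ ∘ₗ h ∘ₗ τ})

theorem smulRight_mem_rankOneOrNorm {τ : N →ₗ[ℤ] N} {α : N →ₗ[ℤ] ℤ} {a : N}
    (hα : ∀ x, α (τ x) = α x) (ha : τ a = a) : α.smulRight a ∈ rankOneOrNorm τ :=
  AddSubgroup.subset_closure (.inl ⟨α, a, rfl, .inl ⟨hα, ha⟩⟩)

theorem norm_mem_rankOneOrNorm (τ h : N →ₗ[ℤ] N) : h + τ ∘ₗ h ∘ₗ τ ∈ rankOneOrNorm τ :=
  AddSubgroup.subset_closure (.inr ⟨h, rfl⟩)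

theorem rankOneOrNorm_neg_le (τ : N →ₗ[ℤ] N) : rankOneOrNorm (-τ) ≤ rankOneOrNorm τ := by
  refine (AddSubgroup.closure_le _).2 ?_
  rintro f (⟨α, a, rfl, h | h⟩ | ⟨h, rfl⟩)
  · refine AddSubgroup.subset_closure (.inl ⟨α, a, rfl, .inr ⟨fun x => ?_, ?_⟩⟩)
    · have := h.1 x
      simp only [LinearMap.neg_apply, map_neg] at this
      omega
    · rw [← neg_eq_iff_eq_neg]; exact h.2
  · refine AddSubgroup.subset_closure (.inl ⟨α, a, rfl, .inl ⟨fun x => ?_, ?_⟩⟩)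
    · have := h.1 x
      simp only [LinearMap.neg_apply, map_neg] at this
      omega
    · have := h.2
      rwa [LinearMap.neg_apply, neg_inj] at this
  · refine AddSubgroup.subset_closure (.inr ⟨h, ?_⟩)
    ext x
    simp

theorem comp_mem_rankOneOrNorm {τ g f : N →ₗ[ℤ] N} (hg : ∀ x, g (τ x) = τ (g x))
    (hf : f ∈ rankOneOrNorm τ) : g ∘ₗ f ∈ rankOneOrNorm τ := by
  induction hf using AddSubgroup.closure_induction with
  | mem f hf =>
    obtain ⟨α, a, rfl, h⟩ | ⟨h, rfl⟩ := hf
    · refine AddSubgroup.subset_closure (.inl ⟨α, g a, ?_, ?_⟩)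
      · ext x; simp
      · rw [← hg]
        refine h.imp (fun h => ⟨h.1, by rw [h.2]⟩) (fun h => ⟨h.1, by rw [h.2, map_neg]⟩)
    · refine AddSubgroup.subset_closure (.inr ⟨g ∘ₗ h, ?_⟩)
      ext x; simp [hg]
  | zero => simp [zero_mem]
  | add f₁ f₂ _ _ h₁ h₂ => rw [LinearMap.comp_add]; exact add_mem h₁ h₂
  | neg f _ h => rw [LinearMap.comp_neg]; exact neg_mem h

/-- If `1 - f` and `1 - g` lie in `rankOneOrNorm τ` and `f` is equivariant, then so does
`1 - f g`. -/
theorem id_sub_comp_mem_rankOneOrNorm {τ f g : N →ₗ[ℤ] N} (hf : ∀ x, f (τ x) = τ (f x))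
    (hf₁ : LinearMap.id - f ∈ rankOneOrNorm τ) (hg₁ : LinearMap.id - g ∈ rankOneOrNorm τ) :
    LinearMap.id - f ∘ₗ g ∈ rankOneOrNorm τ := by
  have h := add_mem hf₁ (comp_mem_rankOneOrNorm hf hg₁)
  rwa [LinearMap.comp_sub, LinearMap.comp_id, sub_add_sub_cancel] at h

theorem apply_comm_of_mem_rankOneOrNorm {τ f : N →ₗ[ℤ] N} (hτ : ∀ x, τ (τ x) = x)
    (hf : f ∈ rankOneOrNorm τ) (x : N) : f (τ x) = τ (f x) := by
  induction hf using AddSubgroup.closure_induction with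
  | mem f hf =>
    obtain ⟨α, a, rfl, h | h⟩ | ⟨h, rfl⟩ := hf
    · simp [h.1, h.2]
    · simp [h.1, h.2]
    · simp [hτ, add_comm]
  | zero => simp
  | add f₁ f₂ _ _ h₁ h₂ => simp [h₁, h₂]
  | neg f _ h => simp [h]

theorem exists_comp_eq_of_range_le {P Q : Type*} [AddCommGroup P] [AddCommGroup Q]
    [Module.Projective ℤ P] (f : N →ₗ[ℤ] Q) (g : P →ₗ[ℤ] Q)
    (h : ∀ x, g x ∈ LinearMap.range f) : ∃ w : P →ₗ[ℤ] N, ∀ x, f (w x) = g x := by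
  obtain ⟨w, hw⟩ := Module.projective_lifting_property f.rangeRestrict (g.codRestrict _ h)
    f.surjective_rangeRestrict
  exact ⟨w, fun x => congrArg Subtype.val (LinearMap.congr_fun hw x)⟩

variable [Module.Free ℤ N] [Module.Finite ℤ N]

/-- Modulo endomorphisms factoring through trivial rank-one lattices, the identity is congruent
to an equivariant map sending all invariants to norms. -/
theorem exists_fixed_to_range {τ : N →ₗ[ℤ] N} (hτ : ∀ x, τ (τ x) = x) :
    ∃ p : N →ₗ[ℤ] N, LinearMap.id - p ∈ rankOneOrNorm τ ∧ (∀ x, p (τ x) = τ (p x)) ∧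
      ∀ x, τ x = x → ∃ y, p x = y + τ y := by
  classical
  let F : Submodule ℤ N := LinearMap.ker (LinearMap.id - τ)
  have memF : ∀ {x}, x ∈ F ↔ τ x = x := fun {x} => by
    rw [LinearMap.mem_ker, LinearMap.sub_apply, sub_eq_zero, eq_comm, LinearMap.id_apply]
  let t : N →ₗ[ℤ] F := (LinearMap.id + τ).codRestrict F fun x => by
    rw [memF]; simp [hτ, add_comm]
  have ht : ∀ x, (t x : N) = x + τ x := fun x => rfl
  obtain ⟨n, s⟩ := Submodule.smithNormalForm (Module.finBasis ℤ F) (LinearMap.range t)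
  let e : Fin n → N := fun i => s.bM (s.f i)
  have he : ∀ i, τ (e i) = e i := fun i => memF.1 (s.bM (s.f i)).2
  let α : Fin n → N →ₗ[ℤ] ℤ := fun i => s.bN.coord i ∘ₗ t.rangeRestrict
  have hα : ∀ i x, α i (τ x) = α i x := fun i x => by
    have : t (τ x) = t x := Subtype.ext (by simp [ht, hτ, add_comm])
    have : t.rangeRestrict (τ x) = t.rangeRestrict x := Subtype.ext this
    simp only [α, LinearMap.comp_apply, this]
  have hmem : LinearMap.id - (LinearMap.id - ∑ i, (α i).smulRight ((s.a i / 2) • e i)) ∈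
      rankOneOrNorm τ := by
    rw [sub_sub_cancel]
    exact sum_mem fun i _ => smulRight_mem_rankOneOrNorm (hα i) (by rw [map_smul, he])
  refine ⟨_, hmem, fun x => ?_, fun x hx => ?_⟩
  · have := apply_comm_of_mem_rankOneOrNorm hτ hmem x
    rw [sub_sub_cancel] at this
    simp only [LinearMap.sub_apply, this, LinearMap.id_apply, map_sub]
  · have hsum : ∑ i, α i x • s.a i • s.bM (s.f i) = t x := by
      have := congrArg (fun z => ((z : LinearMap.range t) : F)) (s.bN.sum_repr (t.rangeRestrict x))
      simp only [AddSubmonoidClass.coe_finsetSum, Submodule.coe_smul, s.snf] at this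
      exact this
    let x' : F := ⟨x, memF.2 hx⟩
    have h2 : t x = (2 : ℤ) • x' := Subtype.ext (by simp [ht, hx, x', two_smul])
    have hcoord : ∀ i, α i x * s.a i = 2 * s.bM.repr x' (s.f i) := fun i => by
      have := congrArg (fun z => s.bM.repr z (s.f i)) (hsum.trans h2)
      simpa [Finsupp.single_apply, s.f.injective.eq_iff] using this
    have hdiv : ∀ i, ∃ y, (α i x * s.a i - 2 * (α i x * (s.a i / 2))) • e i =
        (2 : ℤ) • (y + τ y) := fun i => by
      obtain ⟨c, hc⟩ : (2 : ℤ) ∣ α i x * s.a i - 2 * (α i x * (s.a i / 2)) := by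
        rw [hcoord, ← mul_sub]; exact dvd_mul_right _ _
      obtain h | h := Int.emod_two_eq_zero_or_one (s.a i)
      · have : α i x * s.a i - 2 * (α i x * (s.a i / 2)) = 0 := by
          have h3 : s.a i = 2 * (s.a i / 2) := by omega
          linear_combination α i x * h3
        exact ⟨0, by simp [this]⟩
      · obtain ⟨v, hv⟩ := (s.bN i).2
        have hv' : v + τ v = s.a i • e i := by
          rw [← ht, hv, s.snf]; rfl
        have h3 : s.a i = 2 * (s.a i / 2) + 1 := by omega
        refine ⟨c • (v - (s.a i / 2) • e i), ?_⟩
        have h4 : (v - (s.a i / 2) • e i) + τ (v - (s.a i / 2) • e i) = e i := by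
          rw [map_sub, map_smul, he, sub_add_sub_comm, hv', ← add_smul, ← sub_smul]
          convert one_smul ℤ (e i)
          omega
        rw [hc, map_smul, ← smul_add, h4, mul_smul]
    choose y hy using hdiv
    refine ⟨∑ i, y i, ?_⟩
    have hinj : Function.Injective fun z : N => (2 : ℤ) • z :=
      smul_right_injective N two_ne_zero
    apply hinj
    have hx2 : (2 : ℤ) • x = ∑ i, (α i x * s.a i) • e i := by
      have := congrArg Subtype.val (hsum.trans h2)
      simpa [x', e, mul_smul] using this.symm
    simp only [LinearMap.sub_apply, LinearMap.id_apply, LinearMap.sum_apply,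
      LinearMap.smulRight_apply, smul_sub, map_sum, hx2, ← Finset.sum_add_distrib,
      Finset.smul_sum, ← Finset.sum_sub_distrib, ← hy]
    exact Finset.sum_congr rfl fun i _ => by module

/-- An equivariant endomorphism `p` that sends invariants to norms, and anti-invariants to
elements `y - τ y`, has a square which is a norm. -/
theorem comp_self_mem_rankOneOrNorm {τ p : N →ₗ[ℤ] N} (hτ : ∀ x, τ (τ x) = x)
    (hp : ∀ x, p (τ x) = τ (p x)) (hfix : ∀ x, τ x = x → ∃ y, p x = y + τ y)
    (hanti : ∀ x, τ x = -x → ∃ y, p x = y - τ y) : p ∘ₗ p ∈ rankOneOrNorm τ := by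
  let t : N →ₗ[ℤ] N := LinearMap.id + τ
  let K := LinearMap.ker t
  have ht : ∀ x, t x = x + τ x := fun x => rfl
  have memK : ∀ {x}, x ∈ K ↔ τ x = -x := fun {x} => by
    rw [LinearMap.mem_ker, ht, add_comm, add_eq_zero_iff_eq_neg]
  obtain ⟨s, hs⟩ := exists_comp_eq_of_range_le t (LinearMap.range t).subtype fun x => x.2
  let r : N →ₗ[ℤ] K := (LinearMap.id - s ∘ₗ t.rangeRestrict).codRestrict K fun x => by
    simp [K, LinearMap.mem_ker, hs]
  have hr : ∀ x, (r x : N) = x - s (t.rangeRestrict x) := fun x => rfl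
  have hrK : ∀ x, τ x = -x → (r x : N) = x := fun x hx => by
    have : t.rangeRestrict x = 0 := Subtype.ext (by simp [ht, hx])
    rw [hr, this, map_zero, sub_zero]
  obtain ⟨h₁, hh₁⟩ := exists_comp_eq_of_range_le (LinearMap.id - τ) (p ∘ₗ K.subtype) fun x => by
    obtain ⟨y, hy⟩ := hanti x (memK.1 x.2)
    exact ⟨y, by simp [hy]⟩
  let h := h₁ ∘ₗ r
  let D : N →ₗ[ℤ] N := p - (h + τ ∘ₗ h ∘ₗ τ)
  have hD : ∀ x, D x = p x - (h x + τ (h (τ x))) := fun x => rfl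
  have hDK : ∀ x, τ x = -x → D x = 0 := fun x hx => by
    have := hh₁ (r x)
    simp only [LinearMap.sub_apply, LinearMap.id_apply, LinearMap.comp_apply,
      Submodule.subtype_apply, hrK x hx] at this
    rw [hD, hx, ← this]
    simp only [h, LinearMap.comp_apply, map_neg, ← sub_eq_add_neg, sub_self]
  have hDτ : ∀ x, D (τ x) = τ (D x) := fun x => by
    rw [hD, hD, hτ, hp, map_sub, map_add, hτ, add_comm]
  have hDs : ∀ x, D x = D (s (t.rangeRestrict x)) := fun x => by
    have := hDK _ (memK.1 (r x).2)
    rwa [hr, map_sub, sub_eq_zero] at this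
  obtain ⟨w, hw⟩ := exists_comp_eq_of_range_le t (p ∘ₗ D ∘ₗ s) fun y => by
    have hfixD : τ (D (s y)) = D (s y) := by
      rw [← hDτ, ← sub_eq_zero, ← map_sub]
      exact hDK _ (by simp [hτ])
    obtain ⟨z, hz⟩ := hfix _ hfixD
    exact ⟨z, hz.symm⟩
  have key : p ∘ₗ p = (p ∘ₗ h + w ∘ₗ t.rangeRestrict) +
      τ ∘ₗ (p ∘ₗ h + w ∘ₗ t.rangeRestrict) ∘ₗ τ := by
    ext x
    have h₁ : t.rangeRestrict (τ x) = t.rangeRestrict x :=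
      Subtype.ext (by simp [ht, hτ, add_comm])
    have h₂ := hw (t.rangeRestrict x)
    simp only [LinearMap.comp_apply, ← hDs] at h₂
    rw [ht, hD, map_sub, map_add, hp] at h₂
    simp only [LinearMap.add_apply, LinearMap.comp_apply, h₁, map_add]
    rw [sub_eq_iff_eq_add.1 h₂.symm]
    abel
  rw [key]
  exact norm_mem_rankOneOrNorm τ _

theorem id_mem_rankOneOrNorm {τ : N →ₗ[ℤ] N} (hτ : ∀ x, τ (τ x) = x) :
    LinearMap.id ∈ rankOneOrNorm τ := by
  obtain ⟨p, hp, hpτ, hfix⟩ := exists_fixed_to_range hτ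
  obtain ⟨q, hq, hqτ, hanti⟩ := exists_fixed_to_range (τ := -τ) (by simp [hτ])
  replace hqτ : ∀ x, q (τ x) = τ (q x) := fun x => by simpa using hqτ x
  have hqpτ : ∀ x, (q ∘ₗ p) (τ x) = τ ((q ∘ₗ p) x) := fun x => by simp [hpτ, hqτ]
  have hqp := id_sub_comp_mem_rankOneOrNorm hqτ (rankOneOrNorm_neg_le τ hq) hp
  have hsq := comp_self_mem_rankOneOrNorm hτ hqpτ
    (fun x hx => by
      obtain ⟨y, hy⟩ := hfix x hx
      exact ⟨q y, by simp [hy, hqτ]⟩)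
    (fun x hx => by
      obtain ⟨y, hy⟩ := hanti (p x) (by simp [← hpτ, hx])
      exact ⟨y, by simp [hy, sub_eq_add_neg]⟩)
  simpa using add_mem (id_sub_comp_mem_rankOneOrNorm hqpτ hqp hqp) hsq

end Involution

section SubQuot

variable {R N M : Type*} [CommRing R] [AddCommGroup N] [Module R N] [AddCommGroup M] [Module R M]

theorem SubQuot.mk_eq_zero {f g : N →ₗ[R] N} {x : LinearMap.ker f} :
    (SubQuot.mk x : SubQuot f g) = 0 ↔ (x : N) ∈ LinearMap.range g :=
  Submodule.Quotient.mk_eq_zero _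

/-- The map induced on cohomology quotients by a linear map that preserves kernels and images. -/
def SubQuot.map {f g : N →ₗ[R] N} {f' g' : M →ₗ[R] M} (d : N →ₗ[R] M)
    (hk : ∀ x ∈ LinearMap.ker f, d x ∈ LinearMap.ker f')
    (hr : ∀ x ∈ LinearMap.range g, d x ∈ LinearMap.range g') :
    SubQuot f g →ₗ[R] SubQuot f' g' :=
  Submodule.mapQ _ _ (d.restrict hk) fun x hx => hr x hx

end SubQuot

section Anti

variable {M N : Type*} [AddCommGroup M] [AddCommGroup N] {τM : M →ₗ[ℤ] M} {τN : N →ₗ[ℤ] N}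

theorem mem_ker_one_add {τ : N →ₗ[ℤ] N} {x : N} :
    x ∈ LinearMap.ker (1 + τ : Module.End ℤ N) ↔ τ x = -x := by
  rw [LinearMap.mem_ker, LinearMap.add_apply, Module.End.one_apply, add_comm,
    add_eq_zero_iff_eq_neg]

theorem mem_ker_one_sub {τ : N →ₗ[ℤ] N} {x : N} :
    x ∈ LinearMap.ker (1 - τ : Module.End ℤ N) ↔ τ x = x := by
  rw [LinearMap.mem_ker, LinearMap.sub_apply, Module.End.one_apply, sub_eq_zero, eq_comm]

theorem mem_antiSubgroup_iff (hN : ∀ y, τN (τN y) = y) {d : N →ₗ[ℤ] M} :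
    d ∈ antiSubgroup τM τN ↔ ∀ y, d (τN y) = -τM (d y) := by
  refine ⟨fun h y => ?_, fun h y => ?_⟩
  · have := h (τN y)
    rw [hN] at this
    rw [this, neg_neg]
  · have := h (τN y)
    rw [hN] at this
    rw [this, neg_neg]

theorem coboundary_range_le (hM : ∀ x, τM (τM x) = x) (hN : ∀ y, τN (τN y) = y) :
    (coboundary τM τN).range ≤ antiSubgroup τM τN := by
  rintro _ ⟨m, rfl⟩ y
  simp [coboundary, hM, hN]

theorem apply_mem_ker_one_sub {d : N →ₗ[ℤ] M} (hd : ∀ y, d (τN y) = -τM (d y)) (x : N)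
    (hx : x ∈ LinearMap.ker (1 + τN : Module.End ℤ N)) :
    d x ∈ LinearMap.ker (1 - τM : Module.End ℤ M) := by
  rw [mem_ker_one_add] at hx
  rw [mem_ker_one_sub, ← neg_inj, ← hd, hx, map_neg]

theorem apply_mem_ker_one_add {d : N →ₗ[ℤ] M} (hd : ∀ y, d (τN y) = -τM (d y)) (x : N)
    (hx : x ∈ LinearMap.ker (1 - τN : Module.End ℤ N)) :
    d x ∈ LinearMap.ker (1 + τM : Module.End ℤ M) := by
  rw [mem_ker_one_sub] at hx
  rw [mem_ker_one_add, ← neg_inj, ← hd, hx, neg_neg]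

theorem apply_mem_range_one_add {d : N →ₗ[ℤ] M} (hd : ∀ y, d (τN y) = -τM (d y)) (x : N)
    (hx : x ∈ LinearMap.range (1 - τN : Module.End ℤ N)) :
    d x ∈ LinearMap.range (1 + τM : Module.End ℤ M) := by
  obtain ⟨y, rfl⟩ := hx
  exact ⟨d y, by simp [hd]⟩

theorem apply_mem_range_one_sub {d : N →ₗ[ℤ] M} (hd : ∀ y, d (τN y) = -τM (d y)) (x : N)
    (hx : x ∈ LinearMap.range (1 + τN : Module.End ℤ N)) :
    d x ∈ LinearMap.range (1 - τM : Module.End ℤ M) := by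
  obtain ⟨y, rfl⟩ := hx
  exact ⟨d y, by simp [hd, sub_eq_add_neg]⟩

/-- An anti-equivariant map inducing zero on cohomology becomes a coboundary after composition
with any element of `rankOneOrNorm τN`. -/
theorem comp_mem_range_coboundary {d : N →ₗ[ℤ] M} (hd : ∀ y, d (τN y) = -τM (d y))
    (h₁ : ∀ x, τN x = -x → d x ∈ LinearMap.range (1 + τM : Module.End ℤ M))
    (h₂ : ∀ x, τN x = x → d x ∈ LinearMap.range (1 - τM : Module.End ℤ M))
    {f : N →ₗ[ℤ] N} (hf : f ∈ rankOneOrNorm τN) : d ∘ₗ f ∈ (coboundary τM τN).range := by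
  induction hf using AddSubgroup.closure_induction with
  | mem f hf =>
    obtain ⟨α, a, rfl, ⟨hα, ha⟩ | ⟨hα, ha⟩⟩ | ⟨h, rfl⟩ := hf
    · obtain ⟨m, hm⟩ := h₂ a ha
      refine ⟨α.smulRight (-m), ?_⟩
      ext x
      simp [coboundary, hα, ← hm, smul_sub]
      abel
    · obtain ⟨m, hm⟩ := h₁ a ha
      refine ⟨α.smulRight (-m), ?_⟩
      ext x
      simp [coboundary, hα, ← hm, smul_add, add_comm]
    · refine ⟨-(d ∘ₗ h), ?_⟩
      ext x
      simp [coboundary, hd]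
      abel
  | zero => simp [zero_mem]
  | add f₁ f₂ _ _ h₁ h₂ => rw [LinearMap.comp_add]; exact add_mem h₁ h₂
  | neg f _ h => rw [LinearMap.comp_neg]; exact neg_mem h

/-- Every pair of homomorphisms between cohomology groups is realised by an anti-equivariant map
after precomposition with any element of `rankOneOrNorm τN`. -/
theorem exists_anti_lift (hN : ∀ y, τN (τN y) = y)
    (φ₁ : SubQuot (1 + τN : Module.End ℤ N) (1 - τN : Module.End ℤ N) →+
      SubQuot (1 - τM : Module.End ℤ M) (1 + τM : Module.End ℤ M))
    (φ₂ : SubQuot (1 - τN : Module.End ℤ N) (1 + τN : Module.End ℤ N) →+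
      SubQuot (1 + τM : Module.End ℤ M) (1 - τM : Module.End ℤ M))
    {f : N →ₗ[ℤ] N} (hf : f ∈ rankOneOrNorm τN) :
    ∃ d : N →ₗ[ℤ] M, (∀ y, d (τN y) = -τM (d y)) ∧
      (∀ (x y : LinearMap.ker (1 + τN : Module.End ℤ N))
        (z : LinearMap.ker (1 - τM : Module.End ℤ M)), (y : N) = f x → (z : M) = d x →
        φ₁ (SubQuot.mk y) = SubQuot.mk z) ∧
      (∀ (x y : LinearMap.ker (1 - τN : Module.End ℤ N))
        (z : LinearMap.ker (1 + τM : Module.End ℤ M)), (y : N) = f x → (z : M) = d x →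
        φ₂ (SubQuot.mk y) = SubQuot.mk z) := by
  induction hf using AddSubgroup.closure_induction with
  | mem f hf =>
    obtain ⟨α, a, rfl, ⟨hα, ha⟩ | ⟨hα, ha⟩⟩ | ⟨h, rfl⟩ := hf
    · obtain ⟨c, hc⟩ := Submodule.Quotient.mk_surjective _
        (φ₂ (SubQuot.mk ⟨a, mem_ker_one_sub.2 ha⟩))
      have hτc := mem_ker_one_add.1 c.2
      refine ⟨α.smulRight (c : M), fun y => by simp [hα, hτc], fun x y z hy hz => ?_,
        fun x y z hy hz => ?_⟩
      · have hx : α x = 0 := by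
          have := hα x
          rw [mem_ker_one_add.1 x.2, map_neg] at this
          omega
        obtain rfl : y = 0 := Subtype.ext (by simp [hy, hx])
        obtain rfl : z = 0 := Subtype.ext (by simp [hz, hx])
        exact map_zero φ₁
      · obtain rfl : y = α x • ⟨a, mem_ker_one_sub.2 ha⟩ := Subtype.ext hy
        obtain rfl : z = α x • c := Subtype.ext hz
        rw [SubQuot.mk, SubQuot.mk, Submodule.Quotient.mk_smul, Submodule.Quotient.mk_smul, hc]
        exact map_zsmul φ₂ _ _
    · obtain ⟨c, hc⟩ := Submodule.Quotient.mk_surjective _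
        (φ₁ (SubQuot.mk ⟨a, mem_ker_one_add.2 ha⟩))
      have hτc := mem_ker_one_sub.1 c.2
      refine ⟨α.smulRight (c : M), fun y => by simp [hα, hτc], fun x y z hy hz => ?_,
        fun x y z hy hz => ?_⟩
      · obtain rfl : y = α x • ⟨a, mem_ker_one_add.2 ha⟩ := Subtype.ext hy
        obtain rfl : z = α x • c := Subtype.ext hz
        rw [SubQuot.mk, SubQuot.mk, Submodule.Quotient.mk_smul, Submodule.Quotient.mk_smul, hc]
        exact map_zsmul φ₁ _ _
      · have hx : α x = 0 := by
          have := hα x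
          rw [mem_ker_one_sub.1 x.2] at this
          omega
        obtain rfl : y = 0 := Subtype.ext (by simp [hy, hx])
        obtain rfl : z = 0 := Subtype.ext (by simp [hz, hx])
        exact map_zero φ₂
    · refine ⟨0, by simp, fun x y z hy hz => ?_, fun x y z hy hz => ?_⟩
      · obtain rfl : z = 0 := Subtype.ext hz
        have : (SubQuot.mk y : SubQuot _ (1 - τN : Module.End ℤ N)) = 0 :=
          SubQuot.mk_eq_zero.2 ⟨h x, by simp [hy, mem_ker_one_add.1 x.2, sub_eq_add_neg]⟩
        rw [this]
        exact map_zero φ₁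
      · obtain rfl : z = 0 := Subtype.ext hz
        have : (SubQuot.mk y : SubQuot _ (1 + τN : Module.End ℤ N)) = 0 :=
          SubQuot.mk_eq_zero.2 ⟨h x, by simp [hy, mem_ker_one_sub.1 x.2]⟩
        rw [this]
        exact map_zero φ₂
  | zero =>
    refine ⟨0, by simp, fun x y z hy hz => ?_, fun x y z hy hz => ?_⟩
    · obtain rfl : y = 0 := Subtype.ext hy
      obtain rfl : z = 0 := Subtype.ext hz
      exact map_zero φ₁
    · obtain rfl : y = 0 := Subtype.ext hy
      obtain rfl : z = 0 := Subtype.ext hz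
      exact map_zero φ₂
  | add f g hf hg ihf ihg =>
    obtain ⟨d, hd, hd₁, hd₂⟩ := ihf
    obtain ⟨e, he, he₁, he₂⟩ := ihg
    have hfτ := apply_comm_of_mem_rankOneOrNorm hN hf
    have hgτ := apply_comm_of_mem_rankOneOrNorm hN hg
    refine ⟨d + e, fun y => by simp [hd, he, add_comm], fun x y z hy hz => ?_,
      fun x y z hy hz => ?_⟩
    · have hx := mem_ker_one_add.1 x.2
      let y₁ : LinearMap.ker (1 + τN : Module.End ℤ N) :=
        ⟨f x, mem_ker_one_add.2 (by rw [← hfτ, hx, map_neg])⟩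
      let y₂ : LinearMap.ker (1 + τN : Module.End ℤ N) :=
        ⟨g x, mem_ker_one_add.2 (by rw [← hgτ, hx, map_neg])⟩
      let z₁ : LinearMap.ker (1 - τM : Module.End ℤ M) := ⟨d x, apply_mem_ker_one_sub hd x x.2⟩
      let z₂ : LinearMap.ker (1 - τM : Module.End ℤ M) := ⟨e x, apply_mem_ker_one_sub he x x.2⟩
      obtain rfl : y = y₁ + y₂ := Subtype.ext hy
      obtain rfl : z = z₁ + z₂ := Subtype.ext hz
      exact (map_add φ₁ _ _).trans (congrArg₂ _ (hd₁ x y₁ z₁ rfl rfl) (he₁ x y₂ z₂ rfl rfl))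
    · have hx := mem_ker_one_sub.1 x.2
      let y₁ : LinearMap.ker (1 - τN : Module.End ℤ N) :=
        ⟨f x, mem_ker_one_sub.2 (by rw [← hfτ, hx])⟩
      let y₂ : LinearMap.ker (1 - τN : Module.End ℤ N) :=
        ⟨g x, mem_ker_one_sub.2 (by rw [← hgτ, hx])⟩
      let z₁ : LinearMap.ker (1 + τM : Module.End ℤ M) := ⟨d x, apply_mem_ker_one_add hd x x.2⟩
      let z₂ : LinearMap.ker (1 + τM : Module.End ℤ M) := ⟨e x, apply_mem_ker_one_add he x x.2⟩
      obtain rfl : y = y₁ + y₂ := Subtype.ext hy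
      obtain rfl : z = z₁ + z₂ := Subtype.ext hz
      exact (map_add φ₂ _ _).trans (congrArg₂ _ (hd₂ x y₁ z₁ rfl rfl) (he₂ x y₂ z₂ rfl rfl))
  | neg f _ ih =>
    obtain ⟨d, hd, hd₁, hd₂⟩ := ih
    refine ⟨-d, fun y => by simp [hd], fun x y z hy hz => ?_, fun x y z hy hz => ?_⟩
    · have := hd₁ x (-y) (-z) (by simp [hy]) (by simp [hz])
      exact neg_inj.1 ((map_neg φ₁ _).symm.trans this)
    · have := hd₂ x (-y) (-z) (by simp [hy]) (by simp [hz])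
      exact neg_inj.1 ((map_neg φ₂ _).symm.trans this)

/-- The homomorphism sending an anti-equivariant map to the pair of maps it induces on
cohomology. -/
def antiToHom (τM : M →ₗ[ℤ] M) {τN : N →ₗ[ℤ] N} (hN : ∀ y, τN (τN y) = y) :
    antiSubgroup τM τN →+
      (SubQuot (1 + τN : Module.End ℤ N) (1 - τN : Module.End ℤ N) →+
        SubQuot (1 - τM : Module.End ℤ M) (1 + τM : Module.End ℤ M)) ×
      (SubQuot (1 - τN : Module.End ℤ N) (1 + τN : Module.End ℤ N) →+
        SubQuot (1 + τM : Module.End ℤ M) (1 - τM : Module.End ℤ M)) :=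
  AddMonoidHom.mk'
    (fun d =>
      have hd := (mem_antiSubgroup_iff hN).1 d.2
      ((SubQuot.map d.1 (apply_mem_ker_one_sub hd) (apply_mem_range_one_add hd)).toAddMonoidHom,
        (SubQuot.map d.1 (apply_mem_ker_one_add hd) (apply_mem_range_one_sub hd)).toAddMonoidHom))
    fun _ _ => by
      ext x <;> obtain ⟨x, rfl⟩ := Submodule.Quotient.mk_surjective _ x <;> rfl

theorem antiToHom_fst_mk (hN : ∀ y, τN (τN y) = y) (d : antiSubgroup τM τN)
    (x : LinearMap.ker (1 + τN : Module.End ℤ N)) (z : LinearMap.ker (1 - τM : Module.End ℤ M))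
    (hz : (z : M) = d.1 x) : (antiToHom τM hN d).1 (SubQuot.mk x) = SubQuot.mk z := by
  obtain ⟨z, _⟩ := z
  subst hz
  rfl

theorem antiToHom_snd_mk (hN : ∀ y, τN (τN y) = y) (d : antiSubgroup τM τN)
    (x : LinearMap.ker (1 - τN : Module.End ℤ N)) (z : LinearMap.ker (1 + τM : Module.End ℤ M))
    (hz : (z : M) = d.1 x) : (antiToHom τM hN d).2 (SubQuot.mk x) = SubQuot.mk z := by
  obtain ⟨z, _⟩ := z
  subst hz
  rfl

variable [Module.Free ℤ N] [Module.Finite ℤ N]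

theorem antiToHom_surjective (hN : ∀ y, τN (τN y) = y) :
    Function.Surjective (antiToHom τM hN) := by
  rintro ⟨φ₁, φ₂⟩
  obtain ⟨d, hd, hd₁, hd₂⟩ := exists_anti_lift hN φ₁ φ₂ (id_mem_rankOneOrNorm hN)
  refine ⟨⟨d, (mem_antiSubgroup_iff hN).2 hd⟩, Prod.ext ?_ ?_⟩
  · ext x
    obtain ⟨x, rfl⟩ := Submodule.Quotient.mk_surjective _ x
    exact (hd₁ x x ⟨d x, apply_mem_ker_one_sub hd x x.2⟩ rfl rfl).symm
  · ext x
    obtain ⟨x, rfl⟩ := Submodule.Quotient.mk_surjective _ x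
    exact (hd₂ x x ⟨d x, apply_mem_ker_one_add hd x x.2⟩ rfl rfl).symm

theorem ker_antiToHom (hN : ∀ y, τN (τN y) = y) :
    (coboundary τM τN).range.addSubgroupOf (antiSubgroup τM τN) = (antiToHom τM hN).ker := by
  ext d
  rw [AddSubgroup.mem_addSubgroupOf, AddMonoidHom.mem_ker]
  have hd := (mem_antiSubgroup_iff hN).1 d.2
  refine ⟨fun ⟨m, hm⟩ => Prod.ext ?_ ?_, fun h => ?_⟩
  · ext x
    obtain ⟨x, rfl⟩ := Submodule.Quotient.mk_surjective _ x
    refine (antiToHom_fst_mk hN d x ⟨d.1 x, apply_mem_ker_one_sub hd x x.2⟩ rfl).trans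
      (SubQuot.mk_eq_zero.2 ⟨-m x, ?_⟩)
    simp [← hm, coboundary, mem_ker_one_add.1 x.2]
    abel
  · ext x
    obtain ⟨x, rfl⟩ := Submodule.Quotient.mk_surjective _ x
    refine (antiToHom_snd_mk hN d x ⟨d.1 x, apply_mem_ker_one_add hd x x.2⟩ rfl).trans
      (SubQuot.mk_eq_zero.2 ⟨-m x, ?_⟩)
    simp [← hm, coboundary, mem_ker_one_sub.1 x.2]
    abel
  · refine comp_mem_range_coboundary hd (fun x hx => ?_) (fun x hx => ?_)
      (id_mem_rankOneOrNorm hN)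
    · exact SubQuot.mk_eq_zero.1
        (DFunLike.congr_fun (congrArg Prod.fst h) (SubQuot.mk ⟨x, mem_ker_one_add.2 hx⟩))
    · exact SubQuot.mk_eq_zero.1
        (DFunLike.congr_fun (congrArg Prod.snd h) (SubQuot.mk ⟨x, mem_ker_one_sub.2 hx⟩))

end Anti

/-- **Anti-equivariant maps and connecting morphisms.** For ℤ[τ]-lattices `(M,τ_M)` and
`(N,τ_N)`: every anti-equivariant `d : N → M` maps `ker(1+τ_N)` into `ker(1−τ_M)`,
`im(1−τ_N)` into `im(1+τ_M)`, `ker(1−τ_N)` into `ker(1+τ_M)` and `im(1+τ_N)` into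
`im(1−τ_M)`, hence induces `d₁ : H¹(ℤ/2;N) → H²(ℤ/2;M)` and `d₂ : H²(ℤ/2;N) → H¹(ℤ/2;M)`;
the coboundaries `τ_M ∘ m ∘ τ_N − m` form a subgroup of the group of anti-equivariant
maps, and the induced map `[d] ↦ (d₁, d₂)` from the quotient to
`Hom(H¹(N), H²(M)) × Hom(H²(N), H¹(M))` is a group isomorphism. -/
theorem stmt_8 {M N : Type*}
    [AddCommGroup M] [Module ℤ M] [Module.Free ℤ M] [Module.Finite ℤ M]
    [AddCommGroup N] [Module ℤ N] [Module.Free ℤ N] [Module.Finite ℤ N]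
    (τM : M →ₗ[ℤ] M) (τN : N →ₗ[ℤ] N)
    (hM : ∀ x, τM (τM x) = x) (hN : ∀ y, τN (τN y) = y) :
    (∀ d : N →ₗ[ℤ] M, d ∈ antiSubgroup τM τN →
      (∀ x ∈ LinearMap.ker (1 + τN : Module.End ℤ N),
        d x ∈ LinearMap.ker (1 - τM : Module.End ℤ M)) ∧
      (∀ x ∈ LinearMap.range (1 - τN : Module.End ℤ N),
        d x ∈ LinearMap.range (1 + τM : Module.End ℤ M)) ∧
      (∀ x ∈ LinearMap.ker (1 - τN : Module.End ℤ N),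
        d x ∈ LinearMap.ker (1 + τM : Module.End ℤ M)) ∧
      (∀ x ∈ LinearMap.range (1 + τN : Module.End ℤ N),
        d x ∈ LinearMap.range (1 - τM : Module.End ℤ M))) ∧
    (coboundary τM τN).range ≤ antiSubgroup τM τN ∧
    ∃ Φ : (↥(antiSubgroup τM τN) ⧸
          ((coboundary τM τN).range.addSubgroupOf (antiSubgroup τM τN)))
        ≃+ ((SubQuot (1 + τN : Module.End ℤ N) (1 - τN : Module.End ℤ N) →+
              SubQuot (1 - τM : Module.End ℤ M) (1 + τM : Module.End ℤ M)) ×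
            (SubQuot (1 - τN : Module.End ℤ N) (1 + τN : Module.End ℤ N) →+
              SubQuot (1 + τM : Module.End ℤ M) (1 - τM : Module.End ℤ M))),
      ∀ d : ↥(antiSubgroup τM τN),
        (∀ (x : LinearMap.ker (1 + τN : Module.End ℤ N))
            (z : LinearMap.ker (1 - τM : Module.End ℤ M)),
          (z : M) = d.1 x →
            (Φ (QuotientAddGroup.mk d)).1 (SubQuot.mk x) = SubQuot.mk z) ∧
        (∀ (x : LinearMap.ker (1 - τN : Module.End ℤ N))
            (z : LinearMap.ker (1 + τM : Module.End ℤ M)),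
          (z : M) = d.1 x →
            (Φ (QuotientAddGroup.mk d)).2 (SubQuot.mk x) = SubQuot.mk z) := by

  obtain rfl : ‹Module ℤ M› = AddCommGroup.toIntModule M := Subsingleton.elim _ _
  obtain rfl : ‹Module ℤ N› = AddCommGroup.toIntModule N := Subsingleton.elim _ _
  refine ⟨fun d hd => ?_, coboundary_range_le hM hN,
    QuotientAddGroup.liftEquiv _ (antiToHom_surjective hN) (ker_antiToHom hN),
    fun d => ⟨antiToHom_fst_mk hN d, antiToHom_snd_mk hN d⟩⟩
  rw [mem_antiSubgroup_iff hN] at hd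
  exact ⟨apply_mem_ker_one_sub hd, apply_mem_range_one_add hd, apply_mem_ker_one_add hd,
    apply_mem_range_one_sub hd⟩
end

section
/- Let (M, τ*) be a ℤ[τ]-lattice and let σ be the ring involution of the group algebra ℂ[M] determined by σ(c · x^α) = conj(c) · x^{τ*(α)} for c ∈ ℂ and α ∈ M. Then the inclusion M → (ℂ[M])ˣ, α ↦ x^α, induces a group isomorphism ker(1+τ*)/im(1−τ*) ≅ {u ∈ (ℂ[M])ˣ : u · σ(u) = 1}/{v · σ(v)⁻¹ : v ∈ (ℂ[M])ˣ}; that is, H¹(ℤ/2; M) ≅ H¹(ℤ/2; (ℂ[M])ˣ). -/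
/-- The subgroup of units `u` with `u · σ(u) = 1` (the "cocycles" for the involution
`σ`), for a ring endomorphism `σ` of a commutative ring. -/
def unitCocycles {R : Type*} [CommRing R] (σ : R →+* R) : Subgroup Rˣ where
  carrier := {u | u * Units.map σ.toMonoidHom u = 1}
  one_mem' := by simp
  mul_mem' := by
    intro a b ha hb
    simp only [Set.mem_setOf_eq] at *
    rw [map_mul, mul_mul_mul_comm, ha, hb, one_mul]
  inv_mem' := by
    intro a ha
    simp only [Set.mem_setOf_eq] at *
    rw [map_inv, ← mul_inv, ha, inv_one]

/-- The homomorphism `v ↦ v · σ(v)⁻¹` on units (whose range is the subgroup of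
"coboundaries" for the involution `σ`). -/
def unitCoboundaryHom {R : Type*} [CommRing R] (σ : R →+* R) : Rˣ →* Rˣ where
  toFun v := v * (Units.map σ.toMonoidHom v)⁻¹
  map_one' := by simp
  map_mul' a b := by
    simp only [map_mul, mul_inv]
    exact mul_mul_mul_comm a b _ _

/-- Over a semiring without zero divisors, the invertible elements of the algebra of an additive
monoid with two unique sums are monomials. -/
theorem AddMonoidAlgebra.exists_eq_single_of_mul_eq_one {R A : Type*} [Semiring R] [Nontrivial R]
    [NoZeroDivisors R] [AddMonoid A] [TwoUniqueSums A] {x y : AddMonoidAlgebra R A}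
    (h : x * y = 1) : ∃ (a : A) (r : R), x = AddMonoidAlgebra.single a r := by
  classical
  have hxy : (x * y).coeff ≠ 0 := by
    rw [h]
    intro h0
    have := congrArg (fun f : A →₀ R ↦ f 0) h0
    simp [AddMonoidAlgebra.one_def] at this
  have hy : 1 ≤ y.coeff.support.card := by
    rw [Nat.one_le_iff_ne_zero, Finset.card_ne_zero, Finsupp.support_nonempty_iff]
    intro hy
    exact hxy (by rw [AddMonoidAlgebra.coeff_eq_zero.mp hy]; simp)
  have hsum : ∀ p ∈ x.coeff.support ×ˢ y.coeff.support,
      UniqueAdd x.coeff.support y.coeff.support p.1 p.2 → p.1 + p.2 = 0 := by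
    intro p hp hu
    rw [Finset.mem_product, Finsupp.mem_support_iff, Finsupp.mem_support_iff] at hp
    by_contra hne
    have hc := AddMonoidAlgebra.coeff_mul_add_of_uniqueAdd hu
    rw [h, AddMonoidAlgebra.one_def, AddMonoidAlgebra.coeff_single,
      Finsupp.single_eq_of_ne hne] at hc
    exact mul_ne_zero hp.1 hp.2 hc.symm
  have hcard : x.coeff.support.card ≤ 1 := by
    by_contra! hlt
    obtain ⟨p, hp, q, hq, hne, hup, huq⟩ :=
      TwoUniqueSums.uniqueAdd_of_one_lt_card (hlt.trans_le (Nat.le_mul_of_pos_right _ hy))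
    have hmem := Finset.mem_product.mp hq
    have heq := hup hmem.1 hmem.2 ((hsum q hq huq).trans (hsum p hp hup).symm)
    exact hne (Prod.ext heq.1.symm heq.2.symm)
  obtain ⟨a, r, hr⟩ := Finsupp.card_support_le_one'.mp hcard
  exact ⟨a, r, AddMonoidAlgebra.coeff_injective hr⟩

theorem Module.Free.twoUniqueSums_int (M : Type*) [AddCommGroup M] [Module ℤ M]
    [Module.Free ℤ M] : TwoUniqueSums M :=
  TwoUniqueSums.of_injective_addHom
    (Module.Free.chooseBasis ℤ M).repr.toLinearMap.toAddMonoidHom.toAddHom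
    (Module.Free.chooseBasis ℤ M).repr.injective inferInstance

theorem Complex.exists_eq_mul_conj_of_mul_conj_eq_one {c : ℂ} (hc : c * starRingEnd ℂ c = 1) :
    ∃ d : ℂ, d ≠ 0 ∧ c * starRingEnd ℂ d = d := by
  by_cases h : 1 + c = 0
  · refine ⟨Complex.I, Complex.I_ne_zero, ?_⟩
    rw [eq_neg_of_add_eq_zero_right h, Complex.conj_I, neg_mul_neg, one_mul]
  · refine ⟨1 + c, h, ?_⟩
    rw [map_add, map_one, mul_add, hc, mul_one, add_comm]

/-- The monomial `r · x^α` as a unit of the group algebra. -/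
noncomputable def AddMonoidAlgebra.unitSingle {R A : Type*} [CommSemiring R] [AddGroup A] (α : A) (r : Rˣ) :
    (AddMonoidAlgebra R A)ˣ where
  val := AddMonoidAlgebra.single α (r : R)
  inv := AddMonoidAlgebra.single (-α) ((r⁻¹ : Rˣ) : R)
  val_inv := by simp [AddMonoidAlgebra.single_mul_single, AddMonoidAlgebra.one_def]
  inv_val := by simp [AddMonoidAlgebra.single_mul_single, AddMonoidAlgebra.one_def]

theorem AddMonoidAlgebra.exists_eq_unitSingle {R A : Type*} [CommRing R] [IsDomain R]
    [AddCommGroup A] [TwoUniqueSums A] (u : (AddMonoidAlgebra R A)ˣ) :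
    ∃ (α : A) (r : Rˣ), u = AddMonoidAlgebra.unitSingle α r := by
  obtain ⟨a, r, hu⟩ := AddMonoidAlgebra.exists_eq_single_of_mul_eq_one u.mul_inv
  obtain ⟨b, s, hv⟩ := AddMonoidAlgebra.exists_eq_single_of_mul_eq_one u.inv_mul
  have h := u.mul_inv
  rw [hu, hv, AddMonoidAlgebra.single_mul_single, AddMonoidAlgebra.one_def,
    AddMonoidAlgebra.single_inj] at h
  have hrs : r * s = 1 := by
    rcases h with h | h
    · exact h.2
    · exact absurd h.2 one_ne_zero
  exact ⟨a, Units.mkOfMulEqOne r s hrs, Units.ext hu⟩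

/-- The homomorphism out of `ker f / im g` induced by one on `ker f` that kills `im g`. -/
def SubQuot.lift {R N A : Type*} [CommRing R] [AddCommGroup N] [Module R N] [AddGroup A]
    {f g : N →ₗ[R] N} (φ : LinearMap.ker f →+ A)
    (h : ∀ x : LinearMap.ker f, (x : N) ∈ LinearMap.range g → φ x = 0) : SubQuot f g →+ A :=
  QuotientAddGroup.lift
    ((LinearMap.range g).comap (LinearMap.ker f).subtype).toAddSubgroup φ h

theorem SubQuot.lift_injective {R N A : Type*} [CommRing R] [AddCommGroup N] [Module R N]
    [AddGroup A] {f g : N →ₗ[R] N} (φ : LinearMap.ker f →+ A)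
    (h : ∀ x : LinearMap.ker f, φ x = 0 ↔ (x : N) ∈ LinearMap.range g) :
    Function.Injective (SubQuot.lift φ fun x ↦ (h x).mpr) := by
  refine (injective_iff_map_eq_zero _).mpr fun q hq ↦ ?_
  obtain ⟨x, rfl⟩ := Submodule.Quotient.mk_surjective _ q
  exact (Submodule.Quotient.mk_eq_zero _).mpr ((h x).mp hq)

theorem mem_range_unitCoboundaryHom_iff {R : Type*} [CommRing R] (σ : R →+* R) (u : Rˣ) :
    u ∈ (unitCoboundaryHom σ).range ↔ ∃ v : Rˣ, (v : R) = u * σ v := by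
  refine exists_congr fun v ↦ ?_
  change v * (Units.map σ.toMonoidHom v)⁻¹ = u ↔ _
  rw [mul_inv_eq_iff_eq_mul, Units.ext_iff]
  rfl

theorem mem_unitCocycles_iff {R : Type*} [CommRing R] (σ : R →+* R) (u : Rˣ) :
    u ∈ unitCocycles σ ↔ (u : R) * σ u = 1 :=
  Units.ext_iff

/-- **Hilbert 90 for group algebras of lattices.** Let `(M, τ*)` be a ℤ[τ]-lattice and
`σ` the ring involution of `ℂ[M]` with `σ(c·x^α) = conj(c)·x^{τ*α}`. Then the inclusion
`α ↦ x^α` induces a group isomorphism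
`H¹(ℤ/2; M) = ker(1+τ*)/im(1−τ*) ≅ H¹(ℤ/2; (ℂ[M])ˣ) = {u : u·σ(u)=1}/{v·σ(v)⁻¹}`. -/
theorem stmt_10 {M : Type*} [AddCommGroup M] [Module ℤ M]
    [Module.Free ℤ M] [Module.Finite ℤ M]
    (τ : M →ₗ[ℤ] M) (hτ : ∀ α, τ (τ α) = α)
    (σ : AddMonoidAlgebra ℂ M →+* AddMonoidAlgebra ℂ M)
    (hσ : ∀ (c : ℂ) (α : M),
      σ (AddMonoidAlgebra.single α c) = AddMonoidAlgebra.single (τ α) ((starRingEnd ℂ) c)) :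
    ∃ Φ : SubQuot (1 + τ : Module.End ℤ M) (1 - τ : Module.End ℤ M)
        ≃+ Additive (↥(unitCocycles σ) ⧸
            ((unitCoboundaryHom σ).range.subgroupOf (unitCocycles σ))),
      ∀ (α : LinearMap.ker (1 + τ : Module.End ℤ M)) (u : (AddMonoidAlgebra ℂ M)ˣ),
        (u : AddMonoidAlgebra ℂ M) = AddMonoidAlgebra.single (α : M) 1 →
        ∀ hu : u ∈ unitCocycles σ,
          Φ (SubQuot.mk α) =
            Additive.ofMul (QuotientGroup.mk (⟨u, hu⟩ : ↥(unitCocycles σ))) := by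
  have hM : TwoUniqueSums M := Module.Free.twoUniqueSums_int M
  have mem_ker (α : M) : α ∈ LinearMap.ker (1 + τ : Module.End ℤ M) ↔ α + τ α = 0 := Iff.rfl
  have mem_cocycles (α : M) (r : ℂˣ) : AddMonoidAlgebra.unitSingle α r ∈ unitCocycles σ ↔
      α + τ α = 0 ∧ (r : ℂ) * starRingEnd ℂ r = 1 := by
    rw [mem_unitCocycles_iff]
    simp [AddMonoidAlgebra.unitSingle, hσ, AddMonoidAlgebra.single_mul_single,
      AddMonoidAlgebra.one_def, AddMonoidAlgebra.single_inj]
  have eq_iff (α β : M) (r s : ℂˣ) :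
      (AddMonoidAlgebra.unitSingle β s : AddMonoidAlgebra ℂ M) =
        AddMonoidAlgebra.unitSingle α r * σ (AddMonoidAlgebra.unitSingle β s) ↔
      β = α + τ β ∧ (s : ℂ) = r * starRingEnd ℂ s := by
    simp [AddMonoidAlgebra.unitSingle, hσ, AddMonoidAlgebra.single_mul_single,
      AddMonoidAlgebra.single_inj]
  have mem_cocycles_one (α : LinearMap.ker (1 + τ : Module.End ℤ M)) :
      AddMonoidAlgebra.unitSingle (α : M) (1 : ℂˣ) ∈ unitCocycles σ :=
    (mem_cocycles _ _).mpr ⟨(mem_ker _).mp α.2, by simp⟩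
  let monomial (α : LinearMap.ker (1 + τ : Module.End ℤ M)) : ↥(unitCocycles σ) :=
    ⟨AddMonoidAlgebra.unitSingle (α : M) 1, mem_cocycles_one α⟩
  have monomial_add (α β : LinearMap.ker (1 + τ : Module.End ℤ M)) :
      monomial (α + β) = monomial α * monomial β := by
    refine Subtype.ext (Units.ext ?_)
    simp [monomial, AddMonoidAlgebra.unitSingle, AddMonoidAlgebra.single_mul_single]
  let N : Subgroup ↥(unitCocycles σ) := (unitCoboundaryHom σ).range.subgroupOf (unitCocycles σ)
  let f : LinearMap.ker (1 + τ : Module.End ℤ M) →+ Additive (↥(unitCocycles σ) ⧸ N) :=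
    AddMonoidHom.mk' (fun α ↦ Additive.ofMul (QuotientGroup.mk (s := N) (monomial α)))
      fun α β ↦ congrArg (fun v ↦ Additive.ofMul (QuotientGroup.mk (s := N) v)) (monomial_add α β)
  have hker (α : LinearMap.ker (1 + τ : Module.End ℤ M)) :
      f α = 0 ↔ (α : M) ∈ LinearMap.range (1 - τ : Module.End ℤ M) := by
    have h1 : f α = 0 ↔
        AddMonoidAlgebra.unitSingle (α : M) (1 : ℂˣ) ∈ (unitCoboundaryHom σ).range :=
      QuotientGroup.eq_one_iff _
    rw [h1, mem_range_unitCoboundaryHom_iff]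
    constructor
    · rintro ⟨v, hv⟩
      obtain ⟨β, s, rfl⟩ := AddMonoidAlgebra.exists_eq_unitSingle v
      exact ⟨β, sub_eq_of_eq_add ((eq_iff _ _ _ _).mp hv).1⟩
    · rintro ⟨β, hβ⟩
      exact ⟨AddMonoidAlgebra.unitSingle β 1,
        (eq_iff _ _ _ _).mpr ⟨eq_add_of_sub_eq hβ, by simp⟩⟩
  have hsurj : Function.Surjective f := by
    intro q
    obtain ⟨⟨u, hu⟩, rfl⟩ := QuotientGroup.mk_surjective q.toMul
    obtain ⟨α, r, rfl⟩ := AddMonoidAlgebra.exists_eq_unitSingle u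
    obtain ⟨hα, hr⟩ := (mem_cocycles _ _).mp hu
    obtain ⟨d, hd, hdr⟩ := Complex.exists_eq_mul_conj_of_mul_conj_eq_one hr
    refine ⟨⟨α, (mem_ker α).mpr hα⟩, QuotientGroup.eq.mpr ?_⟩
    rw [Subgroup.mem_subgroupOf, mem_range_unitCoboundaryHom_iff]
    refine ⟨AddMonoidAlgebra.unitSingle 0 (Units.mk0 d hd), ?_⟩
    have hdiff : (monomial ⟨α, (mem_ker α).mpr hα⟩ : (AddMonoidAlgebra ℂ M)ˣ)⁻¹ *
        AddMonoidAlgebra.unitSingle α r = AddMonoidAlgebra.unitSingle 0 r := by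
      rw [inv_mul_eq_iff_eq_mul, Units.ext_iff]
      simp [monomial, AddMonoidAlgebra.unitSingle, AddMonoidAlgebra.single_mul_single]
    exact (congrArg _ (congrArg (· * _) (congrArg Units.val hdiff))).mpr
      ((eq_iff _ _ _ _).mpr ⟨by simp, hdr.symm⟩)
  let g := SubQuot.lift (f := (1 + τ : Module.End ℤ M)) (g := (1 - τ : Module.End ℤ M))
    (A := Additive (↥(unitCocycles σ) ⧸ N)) f
    fun α hα ↦ (hker α).mpr hα
  have hg : Function.Injective g := SubQuot.lift_injective (f := (1 + τ : Module.End ℤ M))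
    (g := (1 - τ : Module.End ℤ M)) (A := Additive (↥(unitCocycles σ) ⧸ N)) f hker
  refine ⟨AddEquiv.ofBijective g ⟨hg, ?_⟩, ?_⟩
  · intro q
    obtain ⟨α, rfl⟩ := hsurj q
    exact ⟨SubQuot.mk α, rfl⟩
  · intro α u hα hu
    obtain rfl : AddMonoidAlgebra.unitSingle (α : M) 1 = u := Units.ext hα.symm
    rfl
end
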